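/- arXiv:2306.08950 — 3 statements merged into one kernel-verified Lean document; each statement's English description precedes it below -/
import Mathlib

section
/- Let Q = (I, Ω) be a finite quiver, q a prime power, λ ∈ ℂ^I, and x a representation of Q of dimension α over 𝔽_q. Then every indecomposable direct summand X_j of x over 𝔽_q satisfies (dim X_j) · λ = 0 (euclidean dot product in ℂ) if and only if every indecomposable direct summand Y of x ⊗ 𝔽̄_q (over 𝔽̄_q) satisfies (dim Y) · λ = 0. -/
open Matrix

namespace QRep

variable {I Ω : Type} (src tgt : Ω → I)

/-- A representation of the quiver with arrow set `Ω`, tail map `src`, head map `tgt`,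
of dimension vector `β`, over the field `K`: a matrix of size `β (tgt a) × β (src a)`
for every arrow `a`. -/
def Rep (K : Type) [Field K] (β : I → ℕ) : Type :=
  ∀ a : Ω, Matrix (Fin (β (tgt a))) (Fin (β (src a))) K

/-- Isomorphism of representations (of possibly different dimension vectors). -/
def RepIso {K : Type} [Field K] {β γ : I → ℕ} (x : Rep src tgt K β) (y : Rep src tgt K γ) :
    Prop :=
  ∃ e : ∀ i, (Fin (β i) → K) ≃ₗ[K] (Fin (γ i) → K),
    ∀ a : Ω, (Matrix.mulVecLin (y a)).comp (e (src a) : (Fin (β (src a)) → K) →ₗ[K] _)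
      = ((e (tgt a) : (Fin (β (tgt a)) → K) →ₗ[K] _)).comp (Matrix.mulVecLin (x a))

/-- Direct sum (block diagonal) of two representations. -/
def dsum {K : Type} [Field K] {β γ : I → ℕ} (x : Rep src tgt K β) (y : Rep src tgt K γ) :
    Rep src tgt K (β + γ) :=
  fun a => Matrix.reindex finSumFinEquiv finSumFinEquiv (Matrix.fromBlocks (x a) 0 0 (y a))

/-- A representation is indecomposable if its dimension vector is nonzero and it is not
isomorphic to a direct sum of two representations of nonzero dimension vectors. -/
def Indec {K : Type} [Field K] {β : I → ℕ} (x : Rep src tgt K β) : Prop :=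
  β ≠ 0 ∧ ∀ (β₁ β₂ : I → ℕ) (y : Rep src tgt K β₁) (z : Rep src tgt K β₂),
    β₁ ≠ 0 → β₂ ≠ 0 → ¬ RepIso src tgt x (dsum src tgt y z)

/-- Base change of a representation along a ring homomorphism of fields. -/
def baseChange {K L : Type} [Field K] [Field L] (f : K →+* L) {β : I → ℕ}
    (x : Rep src tgt K β) : Rep src tgt L β :=
  fun a => (x a).map f

/-- `x` is of level at most `V`: every indecomposable direct summand of
`x ⊗ K̄` has dimension vector belonging to `V`. -/
def LevelAtMost {K : Type} [Field K] {β : I → ℕ} (x : Rep src tgt K β)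
    (V : Set (I → ℕ)) : Prop :=
  ∀ (γ δ : I → ℕ) (Y : Rep src tgt (AlgebraicClosure K) γ)
    (z : Rep src tgt (AlgebraicClosure K) δ), Indec src tgt Y →
    RepIso src tgt (baseChange src tgt (algebraMap K (AlgebraicClosure K)) x)
      (dsum src tgt Y z) → γ ∈ V

/-- The action of `GL_β(K)` on representations of dimension vector `β`. -/
def glAct {K : Type} [Field K] {β : I → ℕ} (g : ∀ i, GL (Fin (β i)) K)
    (x : Rep src tgt K β) : Rep src tgt K β :=
  fun a => ((g (tgt a) : Matrix (Fin (β (tgt a))) (Fin (β (tgt a))) K) * x a) *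
    (((g (src a))⁻¹ : GL (Fin (β (src a))) K) : Matrix (Fin (β (src a))) (Fin (β (src a))) K)

/-- The number of `GL_β(K)`-orbits of representations of dimension vector `β`
satisfying the property `P`. -/
noncomputable def orbitCount {K : Type} [Field K] (β : I → ℕ)
    (P : Rep src tgt K β → Prop) : ℕ :=
  Nat.card (Quot fun x y : {x : Rep src tgt K β // P x} =>
    ∃ g : ∀ i, GL (Fin (β i)) K, glAct src tgt g x.1 = y.1)

end QRep

section Fitting

open Polynomial

/-- Fitting's lemma for integral algebras without nontrivial idempotents. -/
theorem isNilpotent_or_isUnit_of_idempotents_trivial {K A : Type*} [Field K] [Ring A]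
    [Algebra K A] [Algebra.IsIntegral K A] (h : ∀ e : A, e * e = e → e = 0 ∨ e = 1) (f : A) :
    IsNilpotent f ∨ IsUnit f := by
  have hne : minpoly K f ≠ 0 := minpoly.ne_zero (Algebra.IsIntegral.isIntegral f)
  obtain ⟨g, hg, hndvd⟩ := (minpoly K f).exists_eq_pow_rootMultiplicity_mul_and_not_dvd hne 0
  set k := (minpoly K f).rootMultiplicity 0
  rw [C_0, sub_zero] at hg hndvd
  have hcop : IsCoprime (X ^ k : K[X]) g :=
    ((irreducible_X.coprime_iff_not_dvd).2 hndvd).pow_left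
  obtain ⟨a, b, hab⟩ := hcop
  have hsum : aeval f a * f ^ k + aeval f b * aeval f g = 1 := by
    have := congrArg (aeval f) hab
    simpa using this
  have hzero : f ^ k * aeval f g = 0 := by
    have := minpoly.aeval K f
    rw [hg] at this
    simpa using this
  have hcomm : ∀ p q : K[X], aeval f p * aeval f q = aeval f q * aeval f p := fun p q => by
    rw [← map_mul, mul_comm, map_mul]
  have hX : ∀ p : K[X], aeval f p * f ^ k = f ^ k * aeval f p := fun p => by
    simpa using hcomm p (X ^ k)
  have hidem : (aeval f a * f ^ k) * (aeval f a * f ^ k) = aeval f a * f ^ k := by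
    have h1 : (aeval f a * f ^ k) * (aeval f b * aeval f g) = 0 := by
      rw [hcomm b g, mul_assoc, ← mul_assoc (f ^ k), hzero, zero_mul, mul_zero]
    have h2 := congrArg (fun t => (aeval f a * f ^ k) * t) hsum
    simpa only [mul_add, h1, add_zero, mul_one] using h2
  rcases h _ hidem with h0 | h1
  · left
    refine ⟨k, ?_⟩
    rw [h0, zero_add] at hsum
    rw [← mul_one (f ^ k), ← hsum, hcomm b g, ← mul_assoc, hzero, zero_mul]
  · right
    rcases Nat.eq_zero_or_pos k with hk | hk
    · rw [hk, pow_zero, one_mul] at hzero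
      rw [hzero, mul_zero, add_zero] at hsum
      have hdvd : minpoly K f ∣ g := minpoly.dvd K f hzero
      rw [hk, pow_zero, one_mul] at hg
      have hc : g.coeff 0 ≠ 0 := fun hc => hndvd (X_dvd_iff.2 hc)
      rw [← hg] at hc
      have hsplit := congrArg (aeval f) (minpoly K f).divX_mul_X_add
      rw [map_add, map_mul, minpoly.aeval, aeval_X, aeval_C] at hsplit
      have hl : aeval f (minpoly K f).divX * f = f * aeval f (minpoly K f).divX := by
        simpa using hcomm (minpoly K f).divX X
      have hu : IsUnit (aeval f (minpoly K f).divX * f) := by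
        rw [eq_neg_of_add_eq_zero_left hsplit]
        exact ((IsUnit.mk0 _ hc).map (algebraMap K A)).neg
      exact ((show Commute _ _ from hl).isUnit_mul_iff.1 hu).2
    · have hk' : f ^ k = f * f ^ (k - 1) := by rw [← pow_succ', Nat.sub_add_cancel hk]
      have hu : IsUnit (f ^ k) := by
        have hc : Commute (aeval f a) (f ^ k) := hX a
        exact (hc.isUnit_mul_iff.1 (h1 ▸ isUnit_one)).2
      exact (isUnit_pow_iff hk.ne').1 hu

theorem isLocalRing_of_idempotents_trivial (K : Type*) {A : Type*} [Field K] [Ring A]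
    [Algebra K A] [Algebra.IsIntegral K A] [Nontrivial A]
    (h : ∀ e : A, e * e = e → e = 0 ∨ e = 1) : IsLocalRing A :=
  IsLocalRing.of_isUnit_or_isUnit_one_sub_self fun a =>
    (isNilpotent_or_isUnit_of_idempotents_trivial (K := K) h a).symm.imp_right
      IsNilpotent.isUnit_one_sub

end Fitting

namespace QRep

variable {I Ω : Type} (src tgt : Ω → I)

section Hom

variable {K : Type} [Field K] {V W : I → Type}
  [∀ i, AddCommGroup (V i)] [∀ i, Module K (V i)]
  [∀ i, AddCommGroup (W i)] [∀ i, Module K (W i)]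

/-- A family of linear maps commuting with the arrows of two families of vector spaces. -/
def IsHom (φ : ∀ a, V (src a) →ₗ[K] V (tgt a)) (ψ : ∀ a, W (src a) →ₗ[K] W (tgt a))
    (f : ∀ i, V i →ₗ[K] W i) : Prop :=
  ∀ a v, ψ a (f (src a) v) = f (tgt a) (φ a v)

/-- The arrows of a matrix representation, as linear maps. -/
def Rep.lin {β : I → ℕ} (x : Rep src tgt K β) (a : Ω) :
    (Fin (β (src a)) → K) →ₗ[K] (Fin (β (tgt a)) → K) :=
  Matrix.mulVecLin (x a)

/-- The endomorphism algebra of a family of vector spaces with arrows. -/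
def endAlg (φ : ∀ a, V (src a) →ₗ[K] V (tgt a)) : Subalgebra K (∀ i, Module.End K (V i)) where
  carrier := {f | IsHom src tgt φ φ f}
  mul_mem' {f g} hf hg a v := by
    simp only [Pi.mul_apply, Module.End.mul_apply]
    rw [hf a, hg a]
  add_mem' {f g} hf hg a v := by
    simp only [Pi.add_apply, LinearMap.add_apply, map_add]
    rw [hf a, hg a]
  algebraMap_mem' c a v := by
    simp [Module.algebraMap_end_apply]

variable {src tgt}

theorem IsHom.comp {U : I → Type} [∀ i, AddCommGroup (U i)] [∀ i, Module K (U i)]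
    {θ : ∀ a, U (src a) →ₗ[K] U (tgt a)}
    {φ : ∀ a, V (src a) →ₗ[K] V (tgt a)} {ψ : ∀ a, W (src a) →ₗ[K] W (tgt a)}
    {g : ∀ i, V i →ₗ[K] W i} {f : ∀ i, U i →ₗ[K] V i} (hg : IsHom src tgt φ ψ g)
    (hf : IsHom src tgt θ φ f) : IsHom src tgt θ ψ fun i => g i ∘ₗ f i := fun a v => by
  simp only [LinearMap.comp_apply]
  rw [hg a, hf a]

/-- Idempotent endomorphisms split. -/
theorem exists_rep_of_idempotent [∀ i, FiniteDimensional K (V i)]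
    {φ : ∀ a, V (src a) →ₗ[K] V (tgt a)} {e : ∀ i, V i →ₗ[K] V i}
    (he : IsHom src tgt φ φ e) (hee : ∀ i v, e i (e i v) = e i v) :
    ∃ (β : I → ℕ) (y : Rep src tgt K β) (s : ∀ i, (Fin (β i) → K) →ₗ[K] V i)
      (r : ∀ i, V i →ₗ[K] (Fin (β i) → K)),
      IsHom src tgt (y.lin src tgt) φ s ∧ IsHom src tgt φ (y.lin src tgt) r ∧
      (∀ i v, r i (s i v) = v) ∧ ∀ i v, s i (r i v) = e i v := by
  let b := fun i => Module.finBasis K (LinearMap.range (e i))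
  let s : ∀ i, (Fin (Module.finrank K (LinearMap.range (e i))) → K) →ₗ[K] V i :=
    fun i => (LinearMap.range (e i)).subtype ∘ₗ (b i).equivFun.symm.toLinearMap
  let r : ∀ i, V i →ₗ[K] (Fin (Module.finrank K (LinearMap.range (e i))) → K) :=
    fun i => (b i).equivFun.toLinearMap ∘ₗ (e i).rangeRestrict
  have hsr : ∀ i v, s i (r i v) = e i v := fun i v => by simp [s, r]
  have hsinj : ∀ i, Function.Injective (s i) := fun i =>
    Subtype.val_injective.comp (b i).equivFun.symm.injective
  have hes : ∀ i v, e i (s i v) = s i v := fun i v => by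
    obtain ⟨w, hw⟩ := ((b i).equivFun.symm v).2
    have : s i v = e i w := hw.symm
    rw [this, hee]
  have hrs : ∀ i v, r i (s i v) = v := fun i v => hsinj i (by rw [hsr, hes])
  let y : Rep src tgt K (fun i => Module.finrank K (LinearMap.range (e i))) :=
    fun a => LinearMap.toMatrix' (r (tgt a) ∘ₗ φ a ∘ₗ s (src a))
  have hy : ∀ a v, y.lin src tgt a v = r (tgt a) (φ a (s (src a) v)) := fun a v => by
    simp only [Rep.lin, y, ← Matrix.toLin'_apply', Matrix.toLin'_toMatrix', LinearMap.comp_apply]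
  refine ⟨_, y, s, r, fun a v => ?_, fun a v => ?_, hrs, hsr⟩
  · rw [hy, hsr, ← he, hes]
  · rw [hy, hsr, he]
    apply hsinj
    rw [hsr, hsr, hee]

end Hom

section Dsum

variable {K : Type} [Field K] {α β γ : I → ℕ}

/-- The splitting of the coordinate space of a block sum. -/
def splitEquiv (K : Type) [Field K] (m n : ℕ) :
    (Fin (m + n) → K) ≃ₗ[K] (Fin m → K) × (Fin n → K) :=
  (LinearEquiv.funCongrLeft K K finSumFinEquiv).trans
    (LinearEquiv.sumArrowLequivProdArrow (Fin m) (Fin n) K K)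

theorem splitEquiv_dsum (y : Rep src tgt K β) (z : Rep src tgt K γ) (a : Ω)
    (v : Fin (β (src a) + γ (src a)) → K) :
    splitEquiv K (β (tgt a)) (γ (tgt a)) ((dsum src tgt y z).lin src tgt a v) =
      (y.lin src tgt a (splitEquiv K _ _ v).1, z.lin src tgt a (splitEquiv K _ _ v).2) := by
  have hv : ∀ j, v j = Sum.elim (splitEquiv K _ _ v).1 (splitEquiv K _ _ v).2
      (finSumFinEquiv.symm j) := fun j => by
    obtain ⟨j, rfl⟩ := finSumFinEquiv.surjective j
    rw [Equiv.symm_apply_apply]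
    cases j <;> rfl
  have key : ∀ k, (dsum src tgt y z).lin src tgt a v (finSumFinEquiv k) =
      (Matrix.fromBlocks (y a) 0 0 (z a) *ᵥ
        Sum.elim (splitEquiv K _ _ v).1 (splitEquiv K _ _ v).2) k := fun k => by
    change ∑ j : Fin (β (src a) + γ (src a)), _ * _ = ∑ j : Fin (β (src a)) ⊕ Fin (γ (src a)), _ * _
    refine (Fintype.sum_equiv finSumFinEquiv _ _ fun j => ?_).symm
    rw [hv, Equiv.symm_apply_apply]
    simp [dsum]
  refine Prod.ext (funext fun k => ?_) (funext fun k => ?_)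
  · refine (key (Sum.inl k)).trans ?_
    rw [Matrix.fromBlocks_mulVec]
    simp [Rep.lin]
  · refine (key (Sum.inr k)).trans ?_
    rw [Matrix.fromBlocks_mulVec]
    simp [Rep.lin]

variable {src tgt}

/-- A complementary pair of retracts yields a direct sum decomposition. -/
theorem repIso_dsum_of_retracts {x : Rep src tgt K α} {y : Rep src tgt K β} {z : Rep src tgt K γ}
    {s₁ : ∀ i, (Fin (β i) → K) →ₗ[K] (Fin (α i) → K)}
    {r₁ : ∀ i, (Fin (α i) → K) →ₗ[K] (Fin (β i) → K)}
    {s₂ : ∀ i, (Fin (γ i) → K) →ₗ[K] (Fin (α i) → K)}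
    {r₂ : ∀ i, (Fin (α i) → K) →ₗ[K] (Fin (γ i) → K)}
    (hr₁ : IsHom src tgt (x.lin src tgt) (y.lin src tgt) r₁)
    (hr₂ : IsHom src tgt (x.lin src tgt) (z.lin src tgt) r₂)
    (h₁ : ∀ i v, r₁ i (s₁ i v) = v) (h₂ : ∀ i v, r₂ i (s₂ i v) = v)
    (h : ∀ i v, s₁ i (r₁ i v) + s₂ i (r₂ i v) = v) :
    RepIso src tgt x (dsum src tgt y z) := by
  have h₁₂ : ∀ i v, r₁ i (s₂ i v) = 0 := fun i v => by
    have := congrArg (r₁ i) (h i (s₂ i v))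
    rwa [map_add, h₁, h₂, add_eq_left] at this
  have h₂₁ : ∀ i v, r₂ i (s₁ i v) = 0 := fun i v => by
    have := congrArg (r₂ i) (h i (s₁ i v))
    rwa [map_add, h₁, h₂, add_eq_right] at this
  let e : ∀ i, (Fin (α i) → K) ≃ₗ[K] (Fin (β i) → K) × (Fin (γ i) → K) := fun i =>
    LinearEquiv.ofLinearMap ((r₁ i).prod (r₂ i)) ((s₁ i).coprod (s₂ i))
      (by
        refine LinearMap.ext fun v => Prod.ext ?_ ?_ <;>
          simp [h₁, h₂, h₁₂, h₂₁])
      (LinearMap.ext fun v => h i v)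
  refine ⟨fun i => (e i).trans (splitEquiv K (β i) (γ i)).symm, fun a => LinearMap.ext fun v => ?_⟩
  apply (splitEquiv K (β (tgt a)) (γ (tgt a))).injective
  refine (splitEquiv_dsum src tgt y z a _).trans ?_
  change _ = splitEquiv K _ _ ((splitEquiv K _ _).symm (e (tgt a) (x.lin src tgt a v)))
  rw [LinearEquiv.apply_symm_apply]
  change (y.lin src tgt a (splitEquiv K _ _ ((splitEquiv K _ _).symm (e (src a) v))).1,
    z.lin src tgt a (splitEquiv K _ _ ((splitEquiv K _ _).symm (e (src a) v))).2) = _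
  rw [LinearEquiv.apply_symm_apply]
  exact Prod.ext (hr₁ a v) (hr₂ a v)

/-- The two summands of a direct sum decomposition are retracts. -/
theorem exists_retracts_of_repIso_dsum {x : Rep src tgt K α} {y : Rep src tgt K β}
    {z : Rep src tgt K γ} (h : RepIso src tgt x (dsum src tgt y z)) :
    α = β + γ ∧ ∃ (s₁ : ∀ i, (Fin (β i) → K) →ₗ[K] (Fin (α i) → K))
      (r₁ : ∀ i, (Fin (α i) → K) →ₗ[K] (Fin (β i) → K))
      (s₂ : ∀ i, (Fin (γ i) → K) →ₗ[K] (Fin (α i) → K))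
      (r₂ : ∀ i, (Fin (α i) → K) →ₗ[K] (Fin (γ i) → K)),
      IsHom src tgt (y.lin src tgt) (x.lin src tgt) s₁ ∧
      IsHom src tgt (x.lin src tgt) (y.lin src tgt) r₁ ∧
      IsHom src tgt (z.lin src tgt) (x.lin src tgt) s₂ ∧
      IsHom src tgt (x.lin src tgt) (z.lin src tgt) r₂ ∧
      (∀ i v, r₁ i (s₁ i v) = v) ∧ ∀ i v, r₂ i (s₂ i v) = v := by
  obtain ⟨e, he⟩ := h
  let E : ∀ i, (Fin (α i) → K) ≃ₗ[K] (Fin (β i) → K) × (Fin (γ i) → K) := fun i =>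
    (e i).trans (splitEquiv K (β i) (γ i))
  have hE : ∀ a v, E (tgt a) (x.lin src tgt a v) =
      (y.lin src tgt a (E (src a) v).1, z.lin src tgt a (E (src a) v).2) := fun a v =>
    (congrArg (splitEquiv K _ _) (LinearMap.congr_fun (he a) v).symm).trans
      (splitEquiv_dsum src tgt y z a _)
  refine ⟨funext fun i => ?_, fun i => (E i).symm.toLinearMap ∘ₗ LinearMap.inl K _ _,
    fun i => LinearMap.fst K _ _ ∘ₗ (E i).toLinearMap,
    fun i => (E i).symm.toLinearMap ∘ₗ LinearMap.inr K _ _,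
    fun i => LinearMap.snd K _ _ ∘ₗ (E i).toLinearMap,
    fun a v => ?_, fun a v => ?_, fun a v => ?_, fun a v => ?_, fun i v => ?_, fun i v => ?_⟩
  · simpa using (E i).finrank_eq
  · apply (E (tgt a)).injective
    rw [hE]
    simp
  · simp [hE]
  · apply (E (tgt a)).injective
    rw [hE]
    simp
  · simp [hE]
  · simp
  · simp

/-- A retract is a direct summand. -/
theorem exists_repIso_dsum_of_retract {x : Rep src tgt K α} {y : Rep src tgt K β}
    {s : ∀ i, (Fin (β i) → K) →ₗ[K] (Fin (α i) → K)}
    {r : ∀ i, (Fin (α i) → K) →ₗ[K] (Fin (β i) → K)}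
    (hs : IsHom src tgt (y.lin src tgt) (x.lin src tgt) s)
    (hr : IsHom src tgt (x.lin src tgt) (y.lin src tgt) r)
    (hrs : ∀ i v, r i (s i v) = v) :
    ∃ (δ : I → ℕ) (z : Rep src tgt K δ), RepIso src tgt x (dsum src tgt y z) := by
  have he : IsHom src tgt (x.lin src tgt) (x.lin src tgt)
      (fun i => LinearMap.id - s i ∘ₗ r i) := fun a v => by
    simp only [LinearMap.sub_apply, LinearMap.id_apply, LinearMap.comp_apply, map_sub]
    rw [hs a, hr a]
  obtain ⟨δ, z, s', r', -, hr', hrs', hsr'⟩ := exists_rep_of_idempotent he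
    (fun i v => by simp [hrs])
  exact ⟨δ, z, repIso_dsum_of_retracts hr hr' hrs hrs' fun i v => by simp [hsr']⟩

/-- The endomorphism ring of an indecomposable representation is local. -/
theorem Indec.isLocalRing_endAlg [Finite I] {x : Rep src tgt K α} (hx : Indec src tgt x) :
    IsLocalRing (endAlg src tgt (V := fun i => Fin (α i) → K) (x.lin src tgt)) := by
  have := Fintype.ofFinite I
  obtain ⟨hα, hx⟩ := hx
  have : Nontrivial (endAlg src tgt (V := fun i => Fin (α i) → K) (x.lin src tgt)) := by
    obtain ⟨i, hi⟩ := Function.ne_iff.1 hα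
    refine ⟨0, 1, fun h => ?_⟩
    have h' : (0 : Module.End K (Fin (α i) → K)) = 1 := congrFun (congrArg Subtype.val h) i
    have : NeZero (α i) := ⟨hi⟩
    exact zero_ne_one h'
  refine isLocalRing_of_idempotents_trivial K ?_
  rintro ⟨e, he⟩ hee
  have hee' : ∀ i v, e i (e i v) = e i v := fun i v =>
    LinearMap.congr_fun (congrFun (congrArg Subtype.val hee) i) v
  replace he : IsHom src tgt (x.lin src tgt) (x.lin src tgt) e := he
  obtain ⟨β, y, s, r, hs, hr, hrs, hsr⟩ := exists_rep_of_idempotent he hee'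
  have he' : IsHom src tgt (x.lin src tgt) (x.lin src tgt) (1 - e) :=
    (endAlg src tgt (V := fun i => Fin (α i) → K) (x.lin src tgt)).sub_mem (one_mem _) he
  obtain ⟨γ, z, s', r', hs', hr', hrs', hsr'⟩ := exists_rep_of_idempotent he'
    (fun i v => by simp [hee'])
  have hzero : ∀ (n : ℕ), n = 0 → ∀ v : Fin n → K, v = 0 := by
    rintro _ rfl v
    exact Subsingleton.elim _ _
  by_cases hβ : β = 0
  · left
    refine Subtype.ext (funext fun i => LinearMap.ext fun v => ?_)
    change e i v = 0
    rw [← hsr, hzero _ (congrFun hβ i) (r i v), map_zero]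
  by_cases hγ : γ = 0
  · right
    refine Subtype.ext (funext fun i => LinearMap.ext fun v => ?_)
    have h := hsr' i v
    rw [hzero _ (congrFun hγ i) (r' i v), map_zero] at h
    exact (sub_eq_zero.1 h.symm).symm
  · refine (hx β γ y z hβ hγ (repIso_dsum_of_retracts hr hr' hrs hrs' fun i v => ?_)).elim
    rw [hsr, hsr']
    simp

end Dsum

/-- If an additive function of the dimension vector vanishes on all indecomposable summands
of `x`, then it vanishes on all summands of finite powers of `x`. -/
theorem sum_eq_zero_of_retract_power {src tgt : Ω → I} [Fintype I] {K : Type} [Field K] {lam : I → ℂ}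
    {α : I → ℕ} {x : Rep src tgt K α}
    (H : ∀ (β δ : I → ℕ) (X : Rep src tgt K β) (z : Rep src tgt K δ),
      Indec src tgt X → RepIso src tgt x (dsum src tgt X z) → ∑ i, (β i : ℂ) * lam i = 0)
    {ι : Type} [Fintype ι] {β : I → ℕ} (S : Rep src tgt K β)
    (s : ι → ∀ i, (Fin (β i) → K) →ₗ[K] (Fin (α i) → K))
    (r : ι → ∀ i, (Fin (α i) → K) →ₗ[K] (Fin (β i) → K))
    (hs : ∀ j, IsHom src tgt (S.lin src tgt) (x.lin src tgt) (s j))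
    (hr : ∀ j, IsHom src tgt (x.lin src tgt) (S.lin src tgt) (r j))
    (hrs : ∀ i v, ∑ j, r j i (s j i v) = v) :
    ∑ i, (β i : ℂ) * lam i = 0 := by
  induction hn : ∑ i, β i using Nat.strong_induction_on generalizing β with
  | _ n ih =>
  by_cases hβ : β = 0
  · simp [hβ]
  by_cases hS : Indec src tgt S
  · have := hS.isLocalRing_endAlg
    let f : ι → endAlg src tgt (V := fun i => Fin (β i) → K) (S.lin src tgt) := fun j =>
      ⟨fun i => r j i ∘ₗ s j i, (hr j).comp (hs j)⟩
    have hf : ∑ j, f j = 1 := by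
      refine Subtype.ext (funext fun i => LinearMap.ext fun v => ?_)
      simpa [f] using hrs i v
    obtain ⟨j, -, u, hu⟩ := IsLocalRing.exists_of_isUnit_sum (s := Finset.univ) (f := f)
      (hf ▸ isUnit_one)
    have hinv : ∀ i v, (u⁻¹.val.val i) (r j i (s j i v)) = v := fun i v => by
      have h := u.inv_mul
      rw [hu] at h
      exact LinearMap.congr_fun (congrFun (congrArg Subtype.val h) i) v
    have hu' : IsHom src tgt (S.lin src tgt) (S.lin src tgt) u⁻¹.val.val := u⁻¹.val.2
    obtain ⟨δ, z, hz⟩ := exists_repIso_dsum_of_retract (hs j) (hu'.comp (hr j)) hinv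
    exact H _ _ S z hS hz
  · simp only [Indec, not_and, not_forall, not_not] at hS
    obtain ⟨β₁, β₂, y, z, h₁, h₂, hyz⟩ := hS hβ
    obtain ⟨rfl, s₁, r₁, s₂, r₂, hs₁, hr₁, hs₂, hr₂, hrs₁, hrs₂⟩ :=
      exists_retracts_of_repIso_dsum hyz
    have hpos : ∀ γ : I → ℕ, γ ≠ 0 → 0 < ∑ i, γ i := fun γ hγ => by
      obtain ⟨i, hi⟩ := Function.ne_iff.1 hγ
      exact (Nat.pos_of_ne_zero hi).trans_le
        (Finset.single_le_sum (f := γ) (fun _ _ => Nat.zero_le _) (Finset.mem_univ i))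
    have hsum : ∑ i, β₁ i + ∑ i, β₂ i = n := by
      rw [← hn, ← Finset.sum_add_distrib]
      rfl
    have e₁ := ih _ (by have := hpos _ h₂; omega) y (fun j i => s j i ∘ₗ s₁ i)
      (fun j i => r₁ i ∘ₗ r j i) (fun j => (hs j).comp hs₁) (fun j => hr₁.comp (hr j))
      (fun i v => by simp only [LinearMap.comp_apply, ← map_sum, hrs, hrs₁]) rfl
    have e₂ := ih _ (by have := hpos _ h₁; omega) z (fun j i => s j i ∘ₗ s₂ i)
      (fun j i => r₂ i ∘ₗ r j i) (fun j => (hs j).comp hs₂) (fun j => hr₂.comp (hr j))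
      (fun i v => by simp only [LinearMap.comp_apply, ← map_sum, hrs, hrs₂]) rfl
    simp only [Pi.add_apply, Nat.cast_add, add_mul, Finset.sum_add_distrib, e₁, e₂, add_zero]

section Matrices

variable {src tgt : Ω → I} {K : Type} [Field K] {α β : I → ℕ}

theorem isHom_mulVecLin_iff {x : Rep src tgt K α} {y : Rep src tgt K β}
    {M : ∀ i, Matrix (Fin (β i)) (Fin (α i)) K} :
    IsHom src tgt (x.lin src tgt) (y.lin src tgt) (fun i => (M i).mulVecLin) ↔
      ∀ a, y a * M (src a) = M (tgt a) * x a := by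
  refine forall_congr' fun a => ?_
  rw [← Matrix.mulVec_injective.eq_iff, funext_iff]
  refine forall_congr' fun v => ?_
  rw [← Matrix.mulVec_mulVec, ← Matrix.mulVec_mulVec]
  rfl

/-- A direct summand is a retract, in terms of matrices. -/
theorem exists_matrices_of_repIso_dsum {δ : I → ℕ} {x : Rep src tgt K α} {y : Rep src tgt K β}
    {z : Rep src tgt K δ} (h : RepIso src tgt x (dsum src tgt y z)) :
    ∃ (s : ∀ i, Matrix (Fin (α i)) (Fin (β i)) K) (r : ∀ i, Matrix (Fin (β i)) (Fin (α i)) K),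
      (∀ a, x a * s (src a) = s (tgt a) * y a) ∧ (∀ a, y a * r (src a) = r (tgt a) * x a) ∧
      ∀ i, r i * s i = 1 := by
  obtain ⟨-, s, r, -, -, hs, hr, -, -, hrs, -⟩ := exists_retracts_of_repIso_dsum h
  have key : ∀ {m n : ℕ} (f : (Fin m → K) →ₗ[K] (Fin n → K)),
      (LinearMap.toMatrix' f).mulVecLin = f := fun f => by
    rw [← Matrix.toLin'_apply', Matrix.toLin'_toMatrix']
  refine ⟨fun i => LinearMap.toMatrix' (s i), fun i => LinearMap.toMatrix' (r i),
    (isHom_mulVecLin_iff (M := fun i => LinearMap.toMatrix' (s i))).1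
      (by simpa only [key] using hs),
    (isHom_mulVecLin_iff (M := fun i => LinearMap.toMatrix' (r i))).1
      (by simpa only [key] using hr), fun i => ?_⟩
  rw [← LinearMap.toMatrix'_comp, ← LinearMap.toMatrix'_id]
  exact congrArg _ (LinearMap.ext (hrs i))

end Matrices

section Descent

variable {src tgt : Ω → I} [Fintype I] {F : Type} [Field F] {lam : I → ℂ} {α : I → ℕ}
  {x : Rep src tgt F α}

/-- If an additive function of the dimension vector vanishes on the indecomposable summands of
`x`, it vanishes on the summands of `x ⊗ L` for any finite extension `L`. -/
theorem sum_eq_zero_of_finite_extension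
    (H : ∀ (β δ : I → ℕ) (X : Rep src tgt F β) (z : Rep src tgt F δ),
      Indec src tgt X → RepIso src tgt x (dsum src tgt X z) → ∑ i, (β i : ℂ) * lam i = 0)
    {L : Type} [Field L] [Algebra F L] [FiniteDimensional F L] {β : I → ℕ}
    {Y : Rep src tgt L β} {s : ∀ i, Matrix (Fin (α i)) (Fin (β i)) L}
    {r : ∀ i, Matrix (Fin (β i)) (Fin (α i)) L}
    (hs : ∀ a, (x a).map (algebraMap F L) * s (src a) = s (tgt a) * Y a)
    (hr : ∀ a, Y a * r (src a) = r (tgt a) * (x a).map (algebraMap F L))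
    (hrs : ∀ i, r i * s i = 1) :
    ∑ i, (β i : ℂ) * lam i = 0 := by
  let φ : ∀ a, (Fin (β (src a)) → L) →ₗ[F] (Fin (β (tgt a)) → L) :=
    fun a => (Y a).mulVecLin.restrictScalars F
  obtain ⟨γ, S, p, q, hp, hq, hqp, hpq⟩ := exists_rep_of_idempotent
    (V := fun i => Fin (β i) → L) (φ := φ) (e := fun _ => LinearMap.id)
    (fun _ _ => rfl) (fun _ _ => rfl)
  have hγ : ∀ i, γ i = β i * Module.finrank F L := fun i => by
    have e : (Fin (γ i) → F) ≃ₗ[F] (Fin (β i) → L) :=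
      LinearEquiv.ofLinearMap (p i) (q i) (LinearMap.ext (hpq i)) (LinearMap.ext (hqp i))
    have h := e.finrank_eq
    rwa [Module.finrank_fin_fun, Module.finrank_pi_fintype, Finset.sum_const, Finset.card_univ,
      Fintype.card_fin, smul_eq_mul] at h
  let b := Module.finBasis F L
  let c : ∀ (j : Fin (Module.finrank F L)) (n : ℕ), (Fin n → L) →ₗ[F] (Fin n → F) :=
    fun j n => (b.coord j).compLeft (Fin n)
  let d : ∀ (j : Fin (Module.finrank F L)) (n : ℕ), (Fin n → F) →ₗ[F] (Fin n → L) :=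
    fun j n => (LinearMap.toSpanSingleton F L (b j)).compLeft (Fin n)
  have hc : ∀ j a v, (x a).mulVec (c j _ v) = c j _ (((x a).map (algebraMap F L)).mulVec v) :=
    fun j a v => funext fun k => by
      simp [c, Matrix.mulVec, dotProduct, ← Algebra.smul_def]
  have hd : ∀ j a v, ((x a).map (algebraMap F L)).mulVec (d j _ v) = d j _ ((x a).mulVec v) :=
    fun j a v => funext fun k => by
      simp [d, Matrix.mulVec, dotProduct, ← Algebra.smul_def, mul_smul, smul_comm (v _)]
  have hdc : ∀ n v, ∑ j, d j n (c j n v) = v := fun n v => funext fun k => by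
    simp [d, c, b.sum_repr]
  let s' : Fin (Module.finrank F L) → ∀ i, (Fin (β i) → L) →ₗ[F] (Fin (α i) → F) :=
    fun j i => c j _ ∘ₗ (s i).mulVecLin.restrictScalars F
  let r' : Fin (Module.finrank F L) → ∀ i, (Fin (α i) → F) →ₗ[F] (Fin (β i) → L) :=
    fun j i => (r i).mulVecLin.restrictScalars F ∘ₗ d j _
  have hs' : ∀ j, IsHom src tgt φ (x.lin src tgt) (s' j) := fun j a v => by
    change (x a).mulVec (c j _ ((s _).mulVec v)) = c j _ ((s _).mulVec ((Y a).mulVec v))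
    rw [hc, Matrix.mulVec_mulVec, hs, Matrix.mulVec_mulVec]
  have hr' : ∀ j, IsHom src tgt (x.lin src tgt) φ (r' j) := fun j a v => by
    change (Y a).mulVec ((r _).mulVec (d j _ v)) = (r _).mulVec (d j _ ((x a).mulVec v))
    rw [← hd, Matrix.mulVec_mulVec, hr, Matrix.mulVec_mulVec]
  have hrs' : ∀ i v, ∑ j, r' j i (s' j i v) = v := fun i v => by
    change ∑ j, (r i).mulVecLin (d j _ (c j _ ((s i).mulVec v))) = v
    rw [← map_sum, hdc, Matrix.mulVecLin_apply, Matrix.mulVec_mulVec, hrs, Matrix.one_mulVec]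
  have h := sum_eq_zero_of_retract_power H S (fun j i => s' j i ∘ₗ p i) (fun j i => q i ∘ₗ r' j i)
    (fun j => (hs' j).comp hp) (fun j => hq.comp (hr' j)) (fun i v => by
      simp only [LinearMap.comp_apply, ← map_sum, hrs', hqp])
  simp only [hγ, Nat.cast_mul, mul_right_comm, ← Finset.sum_mul] at h
  exact (mul_eq_zero.1 h).resolve_right (Nat.cast_ne_zero.2 Module.finrank_pos.ne')

/-- If an additive function of the dimension vector vanishes on the indecomposable summands of
`x`, it vanishes on the summands of `x ⊗ E` for any algebraic extension `E`. -/
theorem sum_eq_zero_of_algebraic_extension [Finite Ω]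
    (H : ∀ (β δ : I → ℕ) (X : Rep src tgt F β) (z : Rep src tgt F δ),
      Indec src tgt X → RepIso src tgt x (dsum src tgt X z) → ∑ i, (β i : ℂ) * lam i = 0)
    {E : Type} [Field E] [Algebra F E] [Algebra.IsAlgebraic F E] {β δ : I → ℕ}
    {Y : Rep src tgt E β} {z : Rep src tgt E δ}
    (h : RepIso src tgt (baseChange src tgt (algebraMap F E) x) (dsum src tgt Y z)) :
    ∑ i, (β i : ℂ) * lam i = 0 := by
  obtain ⟨s, r, hs, hr, hrs⟩ := exists_matrices_of_repIso_dsum h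
  let T : Set E :=
    Set.range (fun k : Σ a : Ω, Fin (β (tgt a)) × Fin (β (src a)) => Y k.1 k.2.1 k.2.2) ∪
    (Set.range (fun k : Σ i, Fin (α i) × Fin (β i) => s k.1 k.2.1 k.2.2) ∪
    Set.range (fun k : Σ i, Fin (β i) × Fin (α i) => r k.1 k.2.1 k.2.2))
  have : Finite T :=
    ((Set.finite_range _).union ((Set.finite_range _).union (Set.finite_range _))).to_subtype
  let L := IntermediateField.adjoin F T
  have : FiniteDimensional F L :=
    IntermediateField.finiteDimensional_adjoin fun t _ => Algebra.IsIntegral.isIntegral t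
  have hT : T ⊆ L := IntermediateField.subset_adjoin F T
  let Y' : Rep src tgt L β := fun a k l => ⟨Y a k l, hT (Or.inl ⟨⟨a, k, l⟩, rfl⟩)⟩
  let s' : ∀ i, Matrix (Fin (α i)) (Fin (β i)) L :=
    fun i k l => ⟨s i k l, hT (Or.inr (Or.inl ⟨⟨i, k, l⟩, rfl⟩))⟩
  let r' : ∀ i, Matrix (Fin (β i)) (Fin (α i)) L :=
    fun i k l => ⟨r i k l, hT (Or.inr (Or.inr ⟨⟨i, k, l⟩, rfl⟩))⟩
  have hinj : ∀ {m n : ℕ} {M N : Matrix (Fin m) (Fin n) L},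
      M.map (algebraMap L E) = N.map (algebraMap L E) → M = N := fun h =>
    Matrix.map_injective (algebraMap L E).injective h
  refine sum_eq_zero_of_finite_extension H (Y := Y') (s := s') (r := r')
    (fun a => hinj ?_) (fun a => hinj ?_) (fun i => hinj ?_)
  · simp only [Matrix.map_mul]
    exact hs a
  · simp only [Matrix.map_mul]
    exact hr a
  · simp only [Matrix.map_mul]
    rw [Matrix.map_one _ (map_zero _) (map_one _)]
    exact hrs i

/-- If an additive function of the dimension vector vanishes on the indecomposable summands of
`x ⊗ E`, it vanishes on the summands of `x`. -/
theorem sum_eq_zero_of_baseChange {E : Type} [Field E] {f : F →+* E}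
    (H : ∀ (β δ : I → ℕ) (Y : Rep src tgt E β) (z : Rep src tgt E δ),
      Indec src tgt Y → RepIso src tgt (baseChange src tgt f x) (dsum src tgt Y z) →
      ∑ i, (β i : ℂ) * lam i = 0)
    {β δ : I → ℕ} {X : Rep src tgt F β} {z : Rep src tgt F δ}
    (h : RepIso src tgt x (dsum src tgt X z)) :
    ∑ i, (β i : ℂ) * lam i = 0 := by
  obtain ⟨s, r, hs, hr, hrs⟩ := exists_matrices_of_repIso_dsum h
  refine sum_eq_zero_of_retract_power (ι := Unit) H (baseChange src tgt f X)
    (fun _ i => ((s i).map f).mulVecLin) (fun _ i => ((r i).map f).mulVecLin)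
    (fun _ => isHom_mulVecLin_iff.2 fun a => ?_) (fun _ => isHom_mulVecLin_iff.2 fun a => ?_)
    (fun i v => ?_)
  · simp only [baseChange, ← Matrix.map_mul, hs]
  · simp only [baseChange, ← Matrix.map_mul, hr]
  · simp only [Finset.univ_unique, Finset.sum_singleton, Matrix.mulVecLin_apply,
      Matrix.mulVec_mulVec, ← Matrix.map_mul, hrs]
    rw [Matrix.map_one _ (map_zero _) (map_one _), Matrix.one_mulVec]

end Descent

end QRep

open QRep in
/-- For a finite quiver `Q`, a finite field `𝔽_q`, `λ ∈ ℂ^I` and a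
representation `x` of dimension `α` over `𝔽_q`: every indecomposable direct summand
`X` of `x` over `𝔽_q` satisfies `(dim X) · λ = 0` iff every indecomposable direct
summand `Y` of `x ⊗ 𝔽̄_q` satisfies `(dim Y) · λ = 0`. -/
theorem statement2 (I Ω : Type) [Fintype I] [Fintype Ω] (src tgt : Ω → I)
    (F : Type) [Field F] [Fintype F] (lam : I → ℂ) (α : I → ℕ)
    (x : Rep src tgt F α) :
    (∀ (β δ : I → ℕ) (X : Rep src tgt F β) (z : Rep src tgt F δ),
        Indec src tgt X → RepIso src tgt x (dsum src tgt X z) →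
        ∑ i, (β i : ℂ) * lam i = 0) ↔
    (∀ (β δ : I → ℕ) (Y : Rep src tgt (AlgebraicClosure F) β)
        (z : Rep src tgt (AlgebraicClosure F) δ),
        Indec src tgt Y →
        RepIso src tgt (baseChange src tgt (algebraMap F (AlgebraicClosure F)) x)
          (dsum src tgt Y z) →
        ∑ i, (β i : ℂ) * lam i = 0) := by
  exact ⟨fun H _ _ _ _ _ h => sum_eq_zero_of_algebraic_extension H h,
    fun H _ _ _ _ _ h => sum_eq_zero_of_baseChange H h⟩
end

section
/- Let Q = (I, Ω) be a finite quiver, q a prime power, α ∈ ℕ^I, and σ = (σ_i)_{i∈I} a tuple of group homomorphisms σ_i : 𝔽_q^× → ℂ^×. Define the linear character ρ : GL_α(𝔽_q) → ℂ^× by ρ((g_i)_{i∈I}) = ∏_{i∈I} σ_i(det g_i), and for δ ∈ ℕ^I write σ^δ = ∏_{i∈I} σ_i^{δ_i}. Then for every representation x ∈ R(Q,α)(𝔽_q), the restriction of ρ to the stabilizer Stab_{GL_α(𝔽_q)}(x) is trivial if and only if every indecomposable direct summand Y of x ⊗ 𝔽̄_q satisfies σ^{dim Y} = 1. -/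
open Matrix

theorem exists_isIdempotentElem_pow {M : Type*} [Monoid M] [Finite M] (a : M) :
    ∃ n : ℕ, n ≠ 0 ∧ IsIdempotentElem (a ^ n) := by
  obtain ⟨m, k, hne, h⟩ := Finite.exists_ne_map_eq_of_infinite (fun n : ℕ => a ^ n)
  wlog hlt : m < k generalizing m k
  · exact this k m hne.symm h.symm (by omega)
  obtain ⟨d, rfl⟩ := Nat.exists_eq_add_of_lt hlt
  have h1 : ∀ j, a ^ (m + j * (d + 1)) = a ^ m := by
    intro j
    induction j with
    | zero => simp
    | succ j ih =>
      rw [show m + (j + 1) * (d + 1) = (m + j * (d + 1)) + (d + 1) by ring, pow_add, ih, ← pow_add]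
      exact h.symm
  refine ⟨(m + 1) * (d + 1), by positivity, ?_⟩
  obtain ⟨s, hs⟩ : ∃ s, (m + 1) * (d + 1) = m + s := ⟨m * d + d + 1, by ring⟩
  rw [IsIdempotentElem, ← pow_add]
  nth_rw 1 [hs]
  rw [show m + s + (m + 1) * (d + 1) = (m + (m + 1) * (d + 1)) + s by ring, pow_add, h1, ← pow_add,
    ← hs]

/-- The inductive step for `exists_isUnit_add_mul`: split off the corner ring of the idempotent
`1 - a ^ n`. -/
theorem exists_isUnit_add_mul_of_isIdempotentElem {A : Type} [Ring A] [Finite A]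
    (IH : ∀ (B : Type) [Ring B] [Finite B], Nat.card B < Nat.card A →
      ∀ p a b : B, p * a + b = 1 → ∃ t, IsUnit (a + t * b))
    {p a b : A} (h : p * a + b = 1) {n : ℕ} (hn : n ≠ 0) (he : IsIdempotentElem (a ^ n))
    (he0 : a ^ n ≠ 0) : ∃ t, IsUnit (a + t * b) := by
  set e := a ^ n with he_def
  have hae : a * e = e * a := by rw [he_def, ← pow_succ, ← pow_succ']
  set f := 1 - e with hf_def
  have hf : IsIdempotentElem f := he.one_sub
  have haf : a * f = f * a := by simp only [hf_def, mul_sub, sub_mul, hae, mul_one, one_mul]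
  have hef : e * f = 0 := by simp [hf_def, mul_sub, he.eq]
  have hfe : f * e = 0 := by simp [hf_def, sub_mul, he.eq]
  have hff : f * f = f := hf
  have hfa : f + e = 1 := by simp [hf_def]
  have key : ∀ y : A, f * (f * y * f) = f * y * f ∧ (f * y * f) * f = f * y * f := by
    intro y
    constructor
    · rw [← mul_assoc, ← mul_assoc, hff]
    · rw [mul_assoc, hff]
  let mk : A → hf.Corner := fun y => ⟨f * y * f, y, rfl⟩
  have hcard : Nat.card hf.Corner < Nat.card A := by
    refine Finite.card_subtype_lt (x := e) ?_
    rintro ⟨y, hy⟩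
    apply he0
    dsimp at hy
    rw [← he.eq]
    nth_rw 2 [← hy]
    rw [← mul_assoc, ← mul_assoc, hef]; simp
  have : Finite hf.Corner := Finite.of_injective (fun y : hf.Corner => y.1) Subtype.val_injective
  obtain ⟨t, ht⟩ := IH hf.Corner hcard (mk p) (mk a) (mk b) (by
    apply Subtype.ext
    change f * p * f * (f * a * f) + f * b * f = f
    have : f * p * f * (f * a * f) = f * (p * a) * f := by
      calc _ = f * p * (f * f) * a * f := by noncomm_ring
        _ = f * p * (f * a) * f := by rw [hff]; noncomm_ring
        _ = f * (p * a) * (f * f) := by rw [← haf]; noncomm_ring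
        _ = _ := by rw [hff]
    rw [this, ← add_mul, ← mul_add, h, mul_one, hff])
  obtain ⟨⟨w, w', hw1, hw2⟩, hw⟩ := ht
  obtain ⟨_, t, rfl⟩ := t
  obtain ⟨_, w, rfl⟩ := w
  obtain ⟨_, w', rfl⟩ := w'
  have hw := congrArg Subtype.val hw
  have hw1 := congrArg Subtype.val hw1
  have hw2 := congrArg Subtype.val hw2
  change f * w * f = f * a * f + f * t * f * (f * b * f) at hw
  change f * w * f * (f * w' * f) = f at hw1
  change f * w' * f * (f * w * f) = f at hw2
  refine ⟨f * t * f, ?_⟩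
  obtain ⟨W, hW⟩ : ∃ W, W = f * w * f := ⟨_, rfl⟩
  obtain ⟨W', hW'⟩ : ∃ W, W = f * w' * f := ⟨_, rfl⟩
  obtain ⟨T, hT⟩ : ∃ W, W = f * t * f := ⟨_, rfl⟩
  have hW3 := key w
  have hW4 := key w'
  have hT2 := key t
  rw [← hT] at hw hT2 ⊢
  rw [← hW] at hw hw1 hw2 hW3
  rw [← hW'] at hw1 hw2 hW4
  have hx : a + T * b = a * e + W + T * b * e := by
    have h3 : f * a * f = a * f := by rw [← haf, mul_assoc, hff]
    have h4 : T * (f * b * f) = T * b * f := by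
      rw [← mul_assoc, ← mul_assoc, hT2.2]
    rw [hw, h3, h4]
    calc _ = a * (f + e) + T * b * (f + e) := by rw [hfa]; simp
      _ = _ := by noncomm_ring
  have hWe : W * e = 0 := by rw [← hW3.2, mul_assoc, hfe, mul_zero]
  have hfWe : W' * e = 0 := by rw [← hW4.2, mul_assoc, hfe, mul_zero]
  have heW' : e * W' = 0 := by rw [← hW4.1, ← mul_assoc, hef, zero_mul]
  have heW : e * W = 0 := by rw [← hW3.1, ← mul_assoc, hef, zero_mul]
  have heT : e * T = 0 := by rw [← hT2.1, ← mul_assoc, hef, zero_mul]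
  obtain ⟨m, rfl⟩ : ∃ m, n = m + 1 := Nat.exists_eq_succ_of_ne_zero hn
  have hca : a ^ m * a = e := by rw [he_def, pow_succ]
  have hac : a * a ^ m = e := by rw [he_def, pow_succ']
  have hce : a ^ m * e = e * a ^ m := by rw [he_def, ← pow_add, ← pow_add, add_comm]
  obtain ⟨c, hc⟩ : ∃ c, c = a ^ m := ⟨_, rfl⟩
  rw [← hc] at hca hac hce
  have hWW' : W * W' = f := hw1
  have hW'W : W' * W = f := hw2
  have hee : e * e = e := he
  rw [hx, isUnit_iff_exists_inv']
  refine ⟨c * e + W' - W' * T * b * e * c, ?_⟩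
  have e1 : (c * e + W' - W' * T * b * e * c) * (a * e + W + T * b * e) =
      c * (e * a) * e + c * (e * W) + c * (e * T) * b * e + W' * (a * e) + W' * W +
        W' * T * b * e - W' * T * b * e * (c * a) * e - W' * T * b * (e * c) * W -
        W' * T * b * (e * c) * T * b * e := by
    noncomm_ring
  rw [e1, hca, heW, heT, ← hae, hae, ← hce]
  have e2 : c * (a * e) * e = e := by
    rw [← mul_assoc, hca, hee, hee]
  rw [hae] at e2
  have e3 : W' * (e * a) = 0 := by rw [← mul_assoc, hfWe, zero_mul]
  have e4 : W' * T * b * e * e * e = W' * T * b * e := by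
    rw [mul_assoc _ e e, hee, mul_assoc _ e e, hee]
  have e5 : W' * T * b * (c * e) * W = 0 := by rw [mul_assoc, mul_assoc c, heW]; simp
  have e6 : W' * T * b * (c * e) * T = 0 := by rw [mul_assoc, mul_assoc c, heT]; simp
  rw [e2, e3, e4, e5, e6, hW'W]
  simp [add_comm e f, hfa]

/-- Finite rings have stable range one. -/
theorem exists_isUnit_add_mul {A : Type} [Ring A] [Finite A] (p a b : A) (h : p * a + b = 1) :
    ∃ t, IsUnit (a + t * b) := by
  induction hN : Nat.card A using Nat.strong_induction_on generalizing A with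
  | _ N ih =>
  subst hN
  replace ih : ∀ (B : Type) [Ring B] [Finite B], Nat.card B < Nat.card A →
      ∀ p a b : B, p * a + b = 1 → ∃ t, IsUnit (a + t * b) :=
    fun B _ _ hB p a b h => ih _ hB p a b h rfl
  cases subsingleton_or_nontrivial A with
  | inl h => exact ⟨0, isUnit_of_subsingleton _⟩
  | inr hA =>
  obtain ⟨n, hn, he⟩ := exists_isIdempotentElem_pow a
  by_cases h0 : a ^ n = 0
  · have hnil : IsNilpotent a := ⟨n, h0⟩
    obtain ⟨k, hk, hk0⟩ : ∃ k, a * a ^ k = 0 ∧ a ^ k ≠ 0 := by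
      have h1 := pow_nilpotencyClass hnil
      have h2 := pos_nilpotencyClass_iff.2 hnil
      refine ⟨nilpotencyClass a - 1, ?_, pow_pred_nilpotencyClass hnil⟩
      rw [← pow_succ', Nat.sub_add_cancel h2, h1]
    have hb : (a + b) * a ^ k = a ^ k := by
      have : b = 1 - p * a := by rw [← h]; simp
      rw [this, add_mul, sub_mul, mul_assoc, hk]; simp
    have hpow : ∀ m, (a + b) ^ m * a ^ k = a ^ k := by
      intro m
      induction m with
      | zero => simp
      | succ m ih => rw [pow_succ, mul_assoc, hb, ih]
    obtain ⟨m, hm, hem⟩ := exists_isIdempotentElem_pow (a + b)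
    obtain ⟨t, ht⟩ := exists_isUnit_add_mul_of_isIdempotentElem ih (p := p) (a := a + b)
      (b := (1 - p) * b) (Eq.trans (by noncomm_ring) h) hm hem
      (fun h => hk0 (by rw [← hpow m, h, zero_mul]))
    refine ⟨1 + t * (1 - p), ?_⟩
    convert ht using 1
    noncomm_ring
  · exact exists_isUnit_add_mul_of_isIdempotentElem ih h hn he h0

section BlockDet

variable {A R : Type} [Ring A] [CommRing R] {n : Type} [Fintype n] [DecidableEq n]

/-- The block matrix obtained by applying a matrix representation of `A` to every entry. -/
def blockMap (φ : A →+* Matrix n n R) {l m : Type} (M : Matrix l m A) :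
    Matrix (l × n) (m × n) R :=
  (M.map φ).comp l m n n R

theorem blockMap_mul (φ : A →+* Matrix n n R) {k l m : Type} [Fintype l] (M : Matrix k l A)
    (N : Matrix l m A) : blockMap φ (M * N) = blockMap φ M * blockMap φ N := by
  ext ⟨i, p⟩ ⟨j, q⟩
  simp [blockMap, Matrix.mul_apply, Fintype.sum_prod_type, Matrix.sum_apply]

theorem blockMap_sub (φ : A →+* Matrix n n R) {l m : Type} (M N : Matrix l m A) :
    blockMap φ (M - N) = blockMap φ M - blockMap φ N := by
  ext ⟨i, p⟩ ⟨j, q⟩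
  simp [blockMap]

theorem blockMap_one (φ : A →+* Matrix n n R) {m : Type} [DecidableEq m] :
    blockMap φ (1 : Matrix m m A) = 1 := by
  rw [blockMap, Matrix.map_one _ (map_zero φ) (map_one φ), Matrix.comp_one]

theorem det_blockMap_reindex (φ : A →+* Matrix n n R) {l m : Type} [Fintype l] [DecidableEq l]
    [Fintype m] [DecidableEq m] (e : l ≃ m) (M : Matrix l l A) :
    (blockMap φ (M.reindex e e)).det = (blockMap φ M).det := by
  rw [← Matrix.det_reindex_self (e.prodCongr (Equiv.refl n)) (blockMap φ M)]
  rfl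

theorem det_blockMap_unit (φ : A →+* Matrix n n R) (M : Matrix Unit Unit A) :
    (blockMap φ M).det = (φ (M () ())).det := by
  rw [← Matrix.det_reindex_self (Equiv.punitProd n) (blockMap φ M)]
  rfl

theorem det_blockMap_fromBlocks (φ : A →+* Matrix n n R) {l m : Type} [Fintype l] [DecidableEq l]
    [Fintype m] [DecidableEq m] {a a' : Matrix l l A} (b : Matrix l m A) (c : Matrix m l A)
    (d : Matrix m m A) (h : a * a' = 1) (h' : a' * a = 1) :
    (blockMap φ (Matrix.fromBlocks a b c d)).det =
      (blockMap φ a).det * (blockMap φ (d - c * a' * b)).det := by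
  let : Invertible (blockMap φ a) :=
    ⟨blockMap φ a', by rw [← blockMap_mul, h', blockMap_one],
      by rw [← blockMap_mul, h, blockMap_one]⟩
  rw [blockMap_sub, blockMap_mul, blockMap_mul, show blockMap φ a' = ⅟(blockMap φ a) from rfl,
    ← Matrix.det_fromBlocks₁₁,
    ← Matrix.det_reindex_self (Equiv.sumProdDistrib l m n)]
  congr 1
  ext (⟨i, p⟩ | ⟨i, p⟩) (⟨j, q⟩ | ⟨j, q⟩) <;> rfl

theorem exists_isUnit_det_blockMap_sum [Finite A] {ι : Type} {n : ι → Type} [∀ i, Fintype (n i)]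
    [∀ i, DecidableEq (n i)] (φ : ∀ i, A →+* Matrix (n i) (n i) R) {m : Type} [Fintype m]
    [DecidableEq m]
    (ih : ∀ U V : Matrix m m A, V * U = 1 →
      ∃ a : A, IsUnit a ∧ ∀ i, (blockMap (φ i) U).det = (φ i a).det)
    (U V : Matrix (Unit ⊕ m) (Unit ⊕ m) A) (h : V * U = 1) :
    ∃ a : A, IsUnit a ∧ ∀ i, (blockMap (φ i) U).det = (φ i a).det := by
  obtain ⟨t, ht⟩ := exists_isUnit_add_mul (V.toBlocks₁₁ () ()) (U.toBlocks₁₁ () ())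
    ((V.toBlocks₁₂ * U.toBlocks₂₁) () ()) (by
      have := congrFun (congrFun h (Sum.inl ())) (Sum.inl ())
      simpa [Matrix.mul_apply, Matrix.toBlocks₁₁, Matrix.toBlocks₁₂, Matrix.toBlocks₂₁] using this)
  obtain ⟨τ, hτ⟩ : ∃ τ : Matrix Unit m A, τ = t • V.toBlocks₁₂ := ⟨_, rfl⟩
  obtain ⟨E, hE⟩ : ∃ E : Matrix (Unit ⊕ m) (Unit ⊕ m) A, E = Matrix.fromBlocks 1 τ 0 1 := ⟨_, rfl⟩
  obtain ⟨E', hE'⟩ : ∃ E : Matrix (Unit ⊕ m) (Unit ⊕ m) A, E = Matrix.fromBlocks 1 (-τ) 0 1 :=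
    ⟨_, rfl⟩
  have hEE : E' * E = 1 := by
    rw [hE, hE', Matrix.fromBlocks_multiply, ← Matrix.fromBlocks_one]
    simp
  have hVU : (V * E') * (E * U) = 1 := by
    rw [Matrix.mul_assoc, ← Matrix.mul_assoc E', hEE, Matrix.one_mul, h]
  have hdetE : ∀ i, (blockMap (φ i) E).det = 1 := by
    intro i
    rw [hE, det_blockMap_fromBlocks (a' := 1) _ _ _ _ (by simp) (by simp)]
    simp [blockMap_one]
  have hdet : ∀ i, (blockMap (φ i) (E * U)).det = (blockMap (φ i) U).det := by
    intro i
    rw [blockMap_mul, Matrix.det_mul, hdetE, one_mul]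
  have ha : (E * U).toBlocks₁₁ () () =
      U.toBlocks₁₁ () () + t * (V.toBlocks₁₂ * U.toBlocks₂₁) () () := by
    simp [hE, hτ, Matrix.mul_apply, Matrix.toBlocks₁₁, Matrix.toBlocks₁₂, Matrix.toBlocks₂₁,
      Finset.mul_sum, mul_assoc]
  rw [← ha] at ht
  obtain ⟨W, hW⟩ : ∃ W, W = E * U := ⟨_, rfl⟩
  obtain ⟨X, hX⟩ : ∃ X, X = V * E' := ⟨_, rfl⟩
  rw [← hW] at ht hVU hdet
  rw [← hX] at hVU
  clear hW hX ha
  obtain ⟨u, hu⟩ := ht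
  obtain ⟨a', ha'⟩ : ∃ a' : Matrix Unit Unit A, a' = Matrix.of fun _ _ => (↑u⁻¹ : A) := ⟨_, rfl⟩
  have h1 : W.toBlocks₁₁ * a' = 1 := by
    ext ⟨⟩ ⟨⟩
    simp [Matrix.mul_apply, ha', ← hu]
  have h2 : a' * W.toBlocks₁₁ = 1 := by
    ext ⟨⟩ ⟨⟩
    simp [Matrix.mul_apply, ha', ← hu]
  rw [← Matrix.fromBlocks_toBlocks W, ← Matrix.fromBlocks_toBlocks X, Matrix.fromBlocks_multiply,
    ← Matrix.fromBlocks_one, Matrix.fromBlocks_inj] at hVU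
  obtain ⟨-, -, h3, h4⟩ := hVU
  obtain ⟨b, hb, hbdet⟩ := ih (W.toBlocks₂₂ - W.toBlocks₂₁ * a' * W.toBlocks₁₂) X.toBlocks₂₂ (by
    have h5 : X.toBlocks₂₂ * W.toBlocks₂₁ = -(X.toBlocks₂₁ * W.toBlocks₁₁) :=
      eq_neg_of_add_eq_zero_right h3
    rw [Matrix.mul_sub, ← Matrix.mul_assoc, ← Matrix.mul_assoc, h5, Matrix.neg_mul,
      Matrix.mul_assoc _ _ a', h1, Matrix.mul_one, Matrix.neg_mul, sub_neg_eq_add, add_comm, h4])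
  refine ⟨u * b, u.isUnit.mul hb, fun i => ?_⟩
  rw [← hdet, ← Matrix.fromBlocks_toBlocks W, det_blockMap_fromBlocks (φ i) _ _ _ h1 h2, hbdet,
    det_blockMap_unit, map_mul, Matrix.det_mul, hu]

/-- Over a finite ring `A`, the block determinants of a left invertible matrix over `A` are those
of a unit of `A`. -/
theorem exists_isUnit_det_blockMap [Finite A] {ι : Type} {n : ι → Type} [∀ i, Fintype (n i)]
    [∀ i, DecidableEq (n i)] (φ : ∀ i, A →+* Matrix (n i) (n i) R) (r : ℕ)
    (U V : Matrix (Fin r) (Fin r) A) (h : V * U = 1) :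
    ∃ a : A, IsUnit a ∧ ∀ i, (blockMap (φ i) U).det = (φ i a).det := by
  induction r with
  | zero => exact ⟨1, isUnit_one, fun i => by simp⟩
  | succ r ih =>
    let e : Fin (r + 1) ≃ Unit ⊕ Fin r := Fintype.equivOfCardEq (by simp [add_comm])
    obtain ⟨a, ha, hdet⟩ := exists_isUnit_det_blockMap_sum φ ih (U.reindex e e) (V.reindex e e) (by
      simp [Matrix.submatrix_mul_equiv, h])
    exact ⟨a, ha, fun i => by rw [← hdet, det_blockMap_reindex]⟩

end BlockDet

theorem Matrix.exists_mul_eq_of_isIdempotentElem {K : Type*} [Field K] {n : Type*} [Fintype n]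
    [DecidableEq n] {E : Matrix n n K} (hE : IsIdempotentElem E) :
    ∃ (κ : Matrix n (Fin (Module.finrank K (LinearMap.range E.mulVecLin))) K)
      (ρ : Matrix (Fin (Module.finrank K (LinearMap.range E.mulVecLin))) n K),
      κ * ρ = E ∧ ρ * κ = 1 := by
  let b := (Module.finBasis K (LinearMap.range E.mulVecLin)).equivFun
  refine ⟨LinearMap.toMatrix' ((LinearMap.range E.mulVecLin).subtype ∘ₗ b.symm.toLinearMap),
    LinearMap.toMatrix' (b.toLinearMap ∘ₗ E.mulVecLin.rangeRestrict), ?_, ?_⟩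
  · rw [← LinearMap.toMatrix'_comp]
    refine Eq.trans (congrArg _ ?_) (LinearMap.toMatrix'_toLin' E)
    refine LinearMap.ext fun x => ?_
    simp
  · rw [← LinearMap.toMatrix'_comp, ← LinearMap.toMatrix'_id]
    congr 1
    refine LinearMap.ext fun x => ?_
    obtain ⟨y, hy⟩ := (b.symm x).2
    have h : E.mulVecLin.rangeRestrict (b.symm x) = b.symm x := by
      ext1
      rw [LinearMap.codRestrict_apply, ← hy, ← LinearMap.comp_apply, ← Matrix.mulVecLin_mul, hE.eq]
    simp [h]

theorem Matrix.mul_toMatrix'_eq_of_comp_eq {K : Type*} [CommRing K] {m n m' n' : Type*}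
    [Fintype m] [DecidableEq m] [Fintype n] [DecidableEq n] [Fintype m'] [DecidableEq m']
    [Fintype n'] [DecidableEq n'] {X : Matrix m n K} {Y : Matrix m' n' K}
    {e : (n → K) →ₗ[K] (n' → K)} {f : (m → K) →ₗ[K] (m' → K)}
    (h : Y.mulVecLin ∘ₗ e = f ∘ₗ X.mulVecLin) :
    Y * LinearMap.toMatrix' e = LinearMap.toMatrix' f * X := by
  apply Matrix.toLin'.injective
  rw [Matrix.toLin'_mul, Matrix.toLin'_mul, Matrix.toLin'_toMatrix', Matrix.toLin'_toMatrix']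
  exact h

theorem Matrix.fromBlocks_submatrix_mul_fromRows {K : Type*} [CommRing K] {l m n o l' n' k : Type*}
    [Fintype n] [Fintype o] [Fintype n'] (A : Matrix l n K) (D : Matrix m o K)
    (B : Matrix n k K) (C : Matrix o k K) (e : l' ≃ l ⊕ m) (f : n' ≃ n ⊕ o) :
    (Matrix.fromBlocks A 0 0 D).submatrix e f * (Matrix.fromRows B C).submatrix f id =
      (Matrix.fromRows (A * B) (D * C)).submatrix e id := by
  rw [Matrix.submatrix_mul_equiv, Matrix.fromBlocks_mul_fromRows]
  simp

theorem Matrix.fromCols_mul_fromBlocks_submatrix {K : Type*} [CommRing K] {l m n o l' n' k : Type*}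
    [Fintype l] [Fintype m] [Fintype l'] (A : Matrix l n K) (D : Matrix m o K)
    (B : Matrix k l K) (C : Matrix k m K) (e : l' ≃ l ⊕ m) (f : n' ≃ n ⊕ o) :
    (Matrix.fromCols B C).submatrix id e * (Matrix.fromBlocks A 0 0 D).submatrix e f =
      (Matrix.fromCols (B * A) (C * D)).submatrix id f := by
  rw [Matrix.submatrix_mul_equiv, Matrix.fromCols_mul_fromBlocks]
  simp

namespace QRep

variable {I Ω : Type} {src tgt : Ω → I} {K : Type} [Field K]

variable (src tgt) in
/-- `W` is a retract, hence a direct summand, of `X`. -/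
def IsRetract {β α : I → ℕ} (W : Rep src tgt K β) (X : Rep src tgt K α) : Prop :=
  ∃ (ι : ∀ i, Matrix (Fin (α i)) (Fin (β i)) K) (π : ∀ i, Matrix (Fin (β i)) (Fin (α i)) K),
    (∀ i, π i * ι i = 1) ∧ (∀ a, X a * ι (src a) = ι (tgt a) * W a) ∧
      ∀ a, W a * π (src a) = π (tgt a) * X a

theorem IsRetract.trans {α β γ : I → ℕ} {W : Rep src tgt K α} {X : Rep src tgt K β}
    {Y : Rep src tgt K γ} (h : IsRetract src tgt W X) (h' : IsRetract src tgt X Y) :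
    IsRetract src tgt W Y := by
  obtain ⟨ι, π, h1, h2, h3⟩ := h
  obtain ⟨ι', π', h1', h2', h3'⟩ := h'
  refine ⟨fun i => ι' i * ι i, fun i => π i * π' i, fun i => ?_, fun a => ?_, fun a => ?_⟩
  · rw [Matrix.mul_assoc, ← Matrix.mul_assoc (π' i), h1', Matrix.one_mul, h1]
  · rw [← Matrix.mul_assoc, h2', Matrix.mul_assoc, h2, Matrix.mul_assoc]
  · rw [← Matrix.mul_assoc, h3, Matrix.mul_assoc, h3', Matrix.mul_assoc]

theorem RepIso.isRetract {α β : I → ℕ} {X : Rep src tgt K α} {Y : Rep src tgt K β}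
    (h : RepIso src tgt X Y) : IsRetract src tgt Y X := by
  obtain ⟨e, he⟩ := h
  let M : ∀ i, Matrix (Fin (β i)) (Fin (α i)) K := fun i => LinearMap.toMatrix' (e i).toLinearMap
  let M' : ∀ i, Matrix (Fin (α i)) (Fin (β i)) K :=
    fun i => LinearMap.toMatrix' (e i).symm.toLinearMap
  have hM : ∀ i, M i * M' i = 1 := fun i => by
    rw [← LinearMap.toMatrix'_comp]
    simp
  have hM' : ∀ i, M' i * M i = 1 := fun i => by
    rw [← LinearMap.toMatrix'_comp]
    simp
  have hc : ∀ a, Y a * M (src a) = M (tgt a) * X a :=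
    fun a => Matrix.mul_toMatrix'_eq_of_comp_eq (he a)
  refine ⟨M', M, hM, fun a => ?_, hc⟩
  calc X a * M' (src a) = M' (tgt a) * M (tgt a) * X a * M' (src a) := by
        rw [hM', Matrix.one_mul]
    _ = M' (tgt a) * (Y a * M (src a)) * M' (src a) := by rw [hc, Matrix.mul_assoc (M' (tgt a))]
    _ = M' (tgt a) * Y a := by rw [Matrix.mul_assoc, Matrix.mul_assoc, hM, Matrix.mul_one]

theorem isRetract_dsum_left {β γ : I → ℕ} (Y : Rep src tgt K β) (z : Rep src tgt K γ) :
    IsRetract src tgt Y (dsum src tgt Y z) := by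
  refine ⟨fun i => (Matrix.fromRows 1 0).submatrix finSumFinEquiv.symm id,
    fun i => (Matrix.fromCols 1 0).submatrix id finSumFinEquiv.symm, fun i => ?_, fun a => ?_,
    fun a => ?_⟩
  · rw [Matrix.submatrix_mul_equiv, Matrix.fromCols_mul_fromRows]
    simp
  · refine (Matrix.fromBlocks_submatrix_mul_fromRows _ _ _ _ _ _).trans ?_
    ext p q
    obtain ⟨p, rfl⟩ := finSumFinEquiv.surjective p
    rcases p with p | p <;> simp [Matrix.mul_apply, Matrix.one_apply]
  · refine Eq.trans ?_ (Matrix.fromCols_mul_fromBlocks_submatrix _ _ _ _ _ _).symm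
    ext p q
    obtain ⟨q, rfl⟩ := finSumFinEquiv.surjective q
    rcases q with q | q <;> simp [Matrix.mul_apply, Matrix.one_apply]

theorem isRetract_dsum_right {β γ : I → ℕ} (Y : Rep src tgt K β) (z : Rep src tgt K γ) :
    IsRetract src tgt z (dsum src tgt Y z) := by
  refine ⟨fun i => (Matrix.fromRows 0 1).submatrix finSumFinEquiv.symm id,
    fun i => (Matrix.fromCols 0 1).submatrix id finSumFinEquiv.symm, fun i => ?_, fun a => ?_,
    fun a => ?_⟩
  · rw [Matrix.submatrix_mul_equiv, Matrix.fromCols_mul_fromRows]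
    simp
  · refine (Matrix.fromBlocks_submatrix_mul_fromRows _ _ _ _ _ _).trans ?_
    ext p q
    obtain ⟨p, rfl⟩ := finSumFinEquiv.surjective p
    rcases p with p | p <;> simp [Matrix.mul_apply, Matrix.one_apply]
  · refine Eq.trans ?_ (Matrix.fromCols_mul_fromBlocks_submatrix _ _ _ _ _ _).symm
    ext p q
    obtain ⟨q, rfl⟩ := finSumFinEquiv.surjective q
    rcases q with q | q <;> simp [Matrix.mul_apply, Matrix.one_apply]

theorem IsRetract.exists_repIso {α β : I → ℕ} {W : Rep src tgt K β} {X : Rep src tgt K α}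
    (h : IsRetract src tgt W X) :
    ∃ (δ : I → ℕ) (z : Rep src tgt K δ), RepIso src tgt X (dsum src tgt W z) := by
  obtain ⟨ι, π, h1, h2, h3⟩ := h
  have hid : ∀ i, IsIdempotentElem (1 - ι i * π i) := fun i => by
    refine IsIdempotentElem.one_sub ?_
    rw [IsIdempotentElem, Matrix.mul_assoc, ← Matrix.mul_assoc (π i), h1, Matrix.one_mul]
  have hex : ∀ i, ∃ (d : ℕ) (κ : Matrix (Fin (α i)) (Fin d) K) (ρ : Matrix (Fin d) (Fin (α i)) K),
      κ * ρ = 1 - ι i * π i ∧ ρ * κ = 1 :=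
    fun i => ⟨_, Matrix.exists_mul_eq_of_isIdempotentElem (hid i)⟩
  choose δ κ ρ hκρ hρκ using hex
  have hπκ : ∀ i, π i * κ i = 0 := fun i => by
    rw [← Matrix.mul_one (κ i), ← hρκ, ← Matrix.mul_assoc (κ i), hκρ, ← Matrix.mul_assoc,
      Matrix.mul_sub, ← Matrix.mul_assoc, h1]
    simp
  have hρι : ∀ i, ρ i * ι i = 0 := fun i => by
    rw [← Matrix.one_mul (ρ i), ← hρκ, Matrix.mul_assoc (ρ i), hκρ, Matrix.mul_assoc,
      Matrix.sub_mul, Matrix.mul_assoc, h1]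
    simp
  have hX : ∀ a, X a * (1 - ι (src a) * π (src a)) =
      (1 - ι (tgt a) * π (tgt a)) * X a := fun a => by
    rw [Matrix.mul_sub, Matrix.sub_mul, Matrix.mul_one, Matrix.one_mul, ← Matrix.mul_assoc, h2,
      Matrix.mul_assoc, h3, Matrix.mul_assoc]
  have hsum : ∀ i, ι i * π i + κ i * ρ i = 1 := fun i => by
    rw [hκρ, add_sub_cancel]
  let z : Rep src tgt K δ := fun a => ρ (tgt a) * X a * κ (src a)
  have hz : ∀ a, z a * ρ (src a) = ρ (tgt a) * X a := fun a => by
    change ρ (tgt a) * X a * κ (src a) * ρ (src a) = _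
    rw [Matrix.mul_assoc, hκρ, Matrix.mul_assoc, hX, ← hκρ, ← Matrix.mul_assoc, ← Matrix.mul_assoc,
      hρκ, Matrix.one_mul]
  let M : ∀ i, Matrix (Fin (α i)) (Fin ((β + δ) i)) K :=
    fun i => (Matrix.fromCols (ι i) (κ i)).submatrix id finSumFinEquiv.symm
  let M' : ∀ i, Matrix (Fin ((β + δ) i)) (Fin (α i)) K :=
    fun i => (Matrix.fromRows (π i) (ρ i)).submatrix finSumFinEquiv.symm id
  have hM : ∀ i, M i * M' i = 1 := fun i => by
    refine (Matrix.submatrix_mul_equiv _ _ _ _ _).trans ?_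
    rw [Matrix.fromCols_mul_fromRows, hsum, Matrix.submatrix_id_id]
  have hM' : ∀ i, M' i * M i = 1 := fun i => by
    refine (Matrix.submatrix_mul _ _ _ _ _ Function.bijective_id).symm.trans ?_
    rw [Matrix.fromRows_mul_fromCols, h1, hπκ, hρι, hρκ, Matrix.fromBlocks_one]
    exact Matrix.submatrix_one_equiv _
  have hc : ∀ a, dsum src tgt W z a * M' (src a) = M' (tgt a) * X a := fun a => by
    refine (Matrix.fromBlocks_submatrix_mul_fromRows _ _ _ _ _ _).trans ?_
    rw [h3, hz, ← Matrix.fromRows_mul]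
    exact Matrix.submatrix_mul _ _ _ _ _ Function.bijective_id
  refine ⟨δ, z, fun i => Matrix.toLin'OfInv (hM i) (hM' i), fun a => ?_⟩
  refine LinearMap.ext fun v => ?_
  change dsum src tgt W z a *ᵥ (M' (src a) *ᵥ v) = M' (tgt a) *ᵥ (X a *ᵥ v)
  rw [Matrix.mulVec_mulVec, hc, Matrix.mulVec_mulVec]

end QRep

namespace QRep

variable {I Ω : Type} {src tgt : Ω → I} {K : Type} [Field K]

theorem exists_isRetract_rootMultiplicity [Finite I] {α : I → ℕ} (X : Rep src tgt K α)
    (g : ∀ i, Matrix (Fin (α i)) (Fin (α i)) K) (hg : ∀ a, X a * g (src a) = g (tgt a) * X a)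
    (μ : K) :
    ∃ W : Rep src tgt K (fun i => (g i).charpoly.rootMultiplicity μ), IsRetract src tgt W X := by
  let T : ∀ i, Module.End K (Fin (α i) → K) := fun i => Matrix.toLin' (g i)
  obtain ⟨N, hN⟩ := ((Filter.eventually_all.2 fun i =>
    ((T i - μ • 1).eventually_isCompl_ker_pow_range_pow.and
      (Filter.eventually_ge_atTop (Module.finrank K (Fin (α i) → K))))).exists)
  have hX : ∀ a v, X a *ᵥ T (src a) v = T (tgt a) (X a *ᵥ v) := fun a v => by
    simp [T, Matrix.mulVec_mulVec, hg]
  have hXN : ∀ a (n : ℕ) v, X a *ᵥ ((T (src a) - μ • 1) ^ n) v =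
      ((T (tgt a) - μ • 1) ^ n) (X a *ᵥ v) := fun a n => by
    induction n with
    | zero => simp
    | succ n ih =>
      intro v
      rw [pow_succ, pow_succ, Module.End.mul_apply, Module.End.mul_apply, ih]
      congr 1
      simp [Matrix.mulVec_sub, hX, Matrix.mulVec_smul]
  let P : ∀ i, Module.End K (Fin (α i) → K) := fun i => Submodule.projection _ _ (hN i).1
  have hP : ∀ a, (X a).mulVecLin ∘ₗ P (src a) = P (tgt a) ∘ₗ (X a).mulVecLin := fun a => by
    refine LinearMap.ext fun v => ?_
    obtain ⟨y, hy, w, hw, rfl⟩ := Submodule.mem_sup.1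
      ((hN (src a)).1.sup_eq_top ▸ Submodule.mem_top : v ∈ _)
    have hy' : X a *ᵥ y ∈ LinearMap.ker ((T (tgt a) - μ • 1) ^ N) := by
      rw [LinearMap.mem_ker, ← hXN, LinearMap.mem_ker.1 hy, Matrix.mulVec_zero]
    have hw' : X a *ᵥ w ∈ LinearMap.range ((T (tgt a) - μ • 1) ^ N) := by
      obtain ⟨u, rfl⟩ := hw
      exact ⟨_, (hXN _ _ _).symm⟩
    simp only [P, LinearMap.comp_apply, map_add, Matrix.mulVecLin_apply]
    rw [Submodule.projection_apply_of_mem_left _ hy, Submodule.projection_apply_of_mem_left _ hy',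
      Submodule.projection_apply_of_mem_right _ hw, Submodule.projection_apply_of_mem_right _ hw',
      Matrix.mulVec_zero]
  let E : ∀ i, Matrix (Fin (α i)) (Fin (α i)) K := fun i => LinearMap.toMatrix' (P i)
  have hE : ∀ i, IsIdempotentElem (E i) := fun i => by
    rw [IsIdempotentElem, ← LinearMap.toMatrix'_mul]
    exact congrArg _ (Submodule.isIdempotentElem_projection (hN i).1)
  have hXE : ∀ a, X a * E (src a) = E (tgt a) * X a :=
    fun a => Matrix.mul_toMatrix'_eq_of_comp_eq (hP a)
  have hdim : ∀ i, Module.finrank K (LinearMap.range (E i).mulVecLin) =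
      (g i).charpoly.rootMultiplicity μ := fun i => by
    have h1 : (E i).mulVecLin = P i := Matrix.toLin'_toMatrix' (P i)
    have h2 : (T i).charpoly = (g i).charpoly := by
      rw [← LinearMap.charpoly_toMatrix (T i) (Pi.basisFun K _), LinearMap.toMatrix_eq_toMatrix',
        LinearMap.toMatrix'_toLin']
    rw [h1, Submodule.range_projection, ← h2, ← LinearMap.finrank_maxGenEigenspace_eq,
      Module.End.maxGenEigenspace_eq_genEigenspace_finrank,
      ← Module.End.genEigenspace_eq_genEigenspace_finrank_of_le _ _ (hN i).2,
      Module.End.genEigenspace_nat]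
  have hex : ∀ i, ∃ (κ : Matrix (Fin (α i)) (Fin ((g i).charpoly.rootMultiplicity μ)) K)
      (ρ : Matrix (Fin ((g i).charpoly.rootMultiplicity μ)) (Fin (α i)) K),
      κ * ρ = E i ∧ ρ * κ = 1 := fun i => by
    rw [← hdim i]
    exact Matrix.exists_mul_eq_of_isIdempotentElem (hE i)
  choose κ ρ hκρ hρκ using hex
  refine ⟨fun a => ρ (tgt a) * X a * κ (src a), κ, ρ, hρκ, fun a => ?_, fun a => ?_⟩
  · rw [← Matrix.mul_assoc, ← Matrix.mul_assoc, hκρ, ← hXE, Matrix.mul_assoc, ← hκρ,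
      Matrix.mul_assoc, hρκ, Matrix.mul_one]
  · rw [Matrix.mul_assoc, hκρ, Matrix.mul_assoc, hXE, ← hκρ, ← Matrix.mul_assoc,
      ← Matrix.mul_assoc, hρκ, Matrix.one_mul]

end QRep

namespace QRep

variable {I Ω : Type} {src tgt : Ω → I} {K : Type} [Field K]

/-- A property of dimension vectors that is additive and holds for the indecomposable direct
summands of `X` holds for all direct summands of `X`. -/
theorem IsRetract.induction_indec [Finite I] {α : I → ℕ} {X : Rep src tgt K α}
    {p : (I → ℕ) → Prop} (h_zero : p 0) (h_add : ∀ β γ, p β → p γ → p (β + γ))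
    (h_indec : ∀ (β δ : I → ℕ) (Y : Rep src tgt K β) (z : Rep src tgt K δ), Indec src tgt Y →
      RepIso src tgt X (dsum src tgt Y z) → p β)
    {β : I → ℕ} {W : Rep src tgt K β} (hW : IsRetract src tgt W X) : p β := by
  have := Fintype.ofFinite I
  induction hn : ∑ i, β i using Nat.strong_induction_on generalizing β with
  | _ n ih =>
  by_cases hβ : β = 0
  · exact hβ ▸ h_zero
  by_cases hind : Indec src tgt W
  · obtain ⟨δ, z, hz⟩ := hW.exists_repIso
    exact h_indec β δ W z hind hz
  simp only [Indec, not_and, not_forall, not_not] at hind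
  obtain ⟨β₁, β₂, y, z, h1, h2, e⟩ := hind hβ
  have hadd : β = β₁ + β₂ := by
    obtain ⟨e, -⟩ := e
    funext i
    simpa using (e i).finrank_eq
  have hpos : ∀ γ : I → ℕ, γ ≠ 0 → 0 < ∑ i, γ i := fun γ hγ => by
    rw [Nat.pos_iff_ne_zero, Ne, Finset.sum_eq_zero_iff]
    exact fun h => hγ (funext fun i => h i (Finset.mem_univ i))
  have hsum : ∑ i, β₁ i + ∑ i, β₂ i = n := by
    rw [← hn, hadd, ← Finset.sum_add_distrib]
    rfl
  have := hpos β₁ h1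
  have := hpos β₂ h2
  rw [hadd]
  exact h_add _ _
    (ih _ (by omega) ((isRetract_dsum_left y z).trans (e.isRetract.trans hW)) rfl)
    (ih _ (by omega) ((isRetract_dsum_right y z).trans (e.isRetract.trans hW)) rfl)

end QRep

theorem FiniteField.prod_det_pow_eq_one {F k I : Type*} [Field F] [Fintype F] [Field k]
    [IsAlgClosed k] [Algebra F k] [Fintype I] {m : I → Type*} [∀ i, Fintype (m i)]
    [∀ i, DecidableEq (m i)] (g : ∀ i, Matrix (m i) (m i) F) (hg : ∀ i, (g i).det ≠ 0) (n : I → ℕ)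
    (h : ∀ μ : k, Fintype.card F - 1 ∣
      ∑ i, n i * ((g i).map (algebraMap F k)).charpoly.rootMultiplicity μ) :
    ∏ i, (g i).det ^ n i = 1 := by
  classical
  set q := Fintype.card F with hq
  have hq1 : 1 < q := Fintype.one_lt_card
  set R : I → Multiset k := fun i => ((g i).map (algebraMap F k)).charpoly.roots with hR
  have hcharpoly : ∀ i, ((g i).map (algebraMap F k)).charpoly =
      (g i).charpoly.map (algebraMap F k) := fun i => Matrix.charpoly_map _ _
  have hfrob : ∀ i, (R i).map (fun y => y ^ q) = R i := fun i => by
    have := (IsAlgClosed.splits ((g i).charpoly.map (algebraMap F k))).roots_map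
      (FiniteField.frobeniusAlgHom F k : k →+* k)
    rw [Polynomial.map_map, AlgHom.comp_algebraMap] at this
    simp only [hR, hcharpoly]
    exact this.symm
  have hdet : ∀ i, algebraMap F k (g i).det = (R i).prod := fun i => by
    rw [hR, ← Matrix.det_eq_prod_roots_charpoly, RingHom.map_det]
    rfl
  obtain ⟨S, hS⟩ := Multiset.exists_smul_of_dvd_count (∑ i, n i • R i) (k := q - 1)
    fun μ _ => by simpa [Multiset.count_sum', hR, Polynomial.count_roots] using h μ
  have hSfrob : S.map (fun y => y ^ q) = S := by
    have : (q - 1) • S.map (fun y => y ^ q) = (q - 1) • S := by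
      rw [← Multiset.map_nsmul, ← hS, ← Multiset.coe_mapAddMonoidHom, map_sum]
      simp [Multiset.map_nsmul, hfrob]
    exact nsmul_right_injective (by omega) this
  have hprod : algebraMap F k (∏ i, (g i).det ^ n i) = S.prod ^ (q - 1) := by
    rw [← Multiset.prod_nsmul, ← hS, map_prod, Multiset.prod_sum]
    simp [Multiset.prod_nsmul, hdet]
  have hSq : S.prod ^ q = S.prod := by
    conv_rhs => rw [← hSfrob]
    rw [Multiset.prod_map_pow, Multiset.map_id']
  have hS0 : S.prod ≠ 0 := by
    intro h0
    rw [h0, zero_pow (by omega), map_eq_zero, Finset.prod_eq_zero_iff] at hprod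
    obtain ⟨i, -, hi⟩ := hprod
    exact pow_ne_zero _ (hg i) hi
  apply (algebraMap F k).injective
  rw [hprod, map_one]
  apply mul_right_cancel₀ hS0
  rw [one_mul, ← pow_succ, Nat.sub_add_cancel hq1.le, hSq]

/-- The characters of the multiplicative group of a finite field form a cyclic group of order
`q - 1`. -/
theorem FiniteField.exists_monoidHom_pow_eq (F : Type*) [Field F] [Fintype F] :
    ∃ τ : Fˣ →* ℂˣ, orderOf τ = Fintype.card F - 1 ∧ ∀ σ : Fˣ →* ℂˣ, ∃ n : ℕ, σ = τ ^ n := by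
  obtain ⟨e⟩ := CommGroup.monoidHom_mulEquiv_of_hasEnoughRootsOfUnity Fˣ ℂ
  obtain ⟨c, hc⟩ := IsCyclic.exists_generator (α := Fˣ)
  refine ⟨e.symm c, ?_, fun σ => ?_⟩
  · classical
    rw [MulEquiv.orderOf_eq, orderOf_eq_card_of_forall_mem_zpowers hc, Nat.card_eq_fintype_card,
      Fintype.card_units]
  · obtain ⟨n, hn⟩ := mem_powers_iff_mem_zpowers.2 (hc (e σ))
    refine ⟨n, e.injective ?_⟩
    rw [map_pow, MulEquiv.apply_symm_apply]
    exact hn.symm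

theorem Matrix.map_algebraMap_mul_map {F E : Type*} [CommRing F] [CommRing E] [Algebra F E]
    {l m n : Type*} [Fintype m] (f : E →ₗ[F] F) (X : Matrix l m F) (M : Matrix m n E) :
    (X.map (algebraMap F E) * M).map f = X * M.map f := by
  ext p q
  simp [Matrix.mul_apply, ← Algebra.smul_def]

theorem Matrix.mul_map_algebraMap_map {F E : Type*} [CommRing F] [CommRing E] [Algebra F E]
    {l m n : Type*} [Fintype m] (f : E →ₗ[F] F) (M : Matrix l m E) (X : Matrix m n F) :
    (M * X.map (algebraMap F E)).map f = M.map f * X := by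
  ext p q
  simp [Matrix.mul_apply, mul_comm _ (algebraMap F E _), ← Algebra.smul_def, mul_comm (X _ _)]

namespace QRep

variable {I Ω : Type} {src tgt : Ω → I} {F : Type} [Field F]

theorem glAct_eq_self_iff {α : I → ℕ} (g : ∀ i, GL (Fin (α i)) F) (x : Rep src tgt F α) :
    glAct src tgt g x = x ↔
      ∀ a, x a * (g (src a) : Matrix (Fin (α (src a))) (Fin (α (src a))) F) =
        (g (tgt a) : Matrix (Fin (α (tgt a))) (Fin (α (tgt a))) F) * x a := by
  refine funext_iff.trans (forall_congr' fun a => ?_)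
  constructor
  · intro h
    conv_lhs => rw [← h]
    rw [glAct, Matrix.mul_assoc, Units.inv_mul, Matrix.mul_one]
  · intro h
    rw [glAct, ← h, Matrix.mul_assoc, Units.mul_inv, Matrix.mul_one]

/-- The endomorphism ring of a representation. -/
def endRing {α : I → ℕ} (x : Rep src tgt F α) :
    Subring (∀ i, Matrix (Fin (α i)) (Fin (α i)) F) where
  carrier := {m | ∀ a, x a * m (src a) = m (tgt a) * x a}
  mul_mem' {m n} hm hn a := by
    rw [Pi.mul_apply, Pi.mul_apply, ← Matrix.mul_assoc, hm a, Matrix.mul_assoc, hn a,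
      Matrix.mul_assoc]
  one_mem' a := by rw [Pi.one_apply, Pi.one_apply, Matrix.mul_one, Matrix.one_mul]
  add_mem' {m n} hm hn a := by
    rw [Pi.add_apply, Pi.add_apply, Matrix.mul_add, Matrix.add_mul, hm a, hn a]
  zero_mem' a := by rw [Pi.zero_apply, Pi.zero_apply, Matrix.mul_zero, Matrix.zero_mul]
  neg_mem' {m} hm a := by
    rw [Pi.neg_apply, Pi.neg_apply, Matrix.mul_neg, Matrix.neg_mul, hm a]

/-- An automorphism of `x ⊗ E` yields an automorphism of `x` whose determinants are the norms of
the determinants of the given one. -/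
theorem exists_glAct_eq_self_det_eq_norm [Finite I] [Finite F] {E : Type} [Field E] [Algebra F E]
    [FiniteDimensional F E] {α : I → ℕ} (x : Rep src tgt F α)
    {u v : ∀ i, Matrix (Fin (α i)) (Fin (α i)) E}
    (hu : ∀ a, (x a).map (algebraMap F E) * u (src a) = u (tgt a) * (x a).map (algebraMap F E))
    (hv : ∀ a, (x a).map (algebraMap F E) * v (src a) = v (tgt a) * (x a).map (algebraMap F E))
    (hvu : ∀ i, v i * u i = 1) :
    ∃ g : ∀ i, GL (Fin (α i)) F, glAct src tgt g x = x ∧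
      ∀ i, (Matrix.GeneralLinearGroup.det (g i) : F) = Algebra.norm F (u i).det := by
  let b := Module.finBasis F E
  let L := Algebra.leftMulMatrix b
  let f : Fin (Module.finrank F E) → Fin (Module.finrank F E) → E →ₗ[F] F :=
    fun j k => Matrix.entryLinearMap F F j k ∘ₗ L.toLinearMap
  let toEnd (w : ∀ i, Matrix (Fin (α i)) (Fin (α i)) E)
      (hw : ∀ a, (x a).map (algebraMap F E) * w (src a) = w (tgt a) * (x a).map (algebraMap F E)) :
      Matrix (Fin (Module.finrank F E)) (Fin (Module.finrank F E)) (endRing x) :=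
    Matrix.of fun j k => ⟨fun i => (w i).map (f j k), fun a => by
      rw [← Matrix.map_algebraMap_mul_map, hw, Matrix.mul_map_algebraMap_map]⟩
  have hVU : toEnd v hv * toEnd u hu = 1 := by
    ext j l i p q
    have h1 : ((toEnd v hv * toEnd u hu) j l : ∀ i, Matrix (Fin (α i)) (Fin (α i)) F) i p q =
        L ((v i * u i) p q) j l := by
      rw [Matrix.mul_apply, Matrix.mul_apply, map_sum]
      simp only [map_mul, Matrix.sum_apply, Matrix.mul_apply, AddSubmonoidClass.coe_finsetSum,
        Finset.sum_apply, MulMemClass.coe_mul, Pi.mul_apply]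
      rw [Finset.sum_comm]
      rfl
    rw [h1, hvu]
    obtain rfl | hjl := eq_or_ne j l <;> obtain rfl | hpq := eq_or_ne p q <;> simp [*]
  let φ : ∀ i, endRing x →+* Matrix (Fin (α i)) (Fin (α i)) F :=
    fun i => (Pi.evalRingHom _ i).comp (endRing x).subtype
  obtain ⟨a, ha, hdet⟩ := exists_isUnit_det_blockMap φ _ _ _ hVU
  refine ⟨fun i => (ha.map (φ i)).unit, (glAct_eq_self_iff _ _).2 a.2, fun i => ?_⟩
  rw [Algebra.norm_eq_matrix_det b]
  change (φ i a).det = (L.toRingHom (u i).det).det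
  rw [← hdet, Matrix.det_det, ← Matrix.det_reindex_self (Equiv.prodComm _ _)]
  rfl

end QRep

namespace QRep

variable {I Ω : Type} {src tgt : Ω → I} {F k : Type} [Field F] [Field k]

/-- A direct summand of `x ⊗ k` of dimension vector `β` gives automorphisms of `x` with
determinants `c ^ β i`. -/
theorem IsRetract.exists_glAct_eq_self [Finite I] [Finite F] [Algebra F k]
    [Algebra.IsAlgebraic F k] {α β : I → ℕ} {x : Rep src tgt F α} {Y : Rep src tgt k β}
    (h : IsRetract src tgt Y (baseChange src tgt (algebraMap F k) x)) (c : Fˣ) :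
    ∃ g : ∀ i, GL (Fin (α i)) F, glAct src tgt g x = x ∧
      ∀ i, Matrix.GeneralLinearGroup.det (g i) = c ^ β i := by
  obtain ⟨ι, π, h1, h2, h3⟩ := h
  let entries : (Σ i, Fin (α i) × Fin (α i)) → k := fun s => (ι s.1 * π s.1) s.2.1 s.2.2
  let E := IntermediateField.adjoin F (Set.range entries)
  have : FiniteDimensional F E :=
    IntermediateField.finiteDimensional_adjoin fun y _ => Algebra.IsIntegral.isIntegral y
  have : Finite E := Module.finite_of_finite F
  let ε : ∀ i, Matrix (Fin (α i)) (Fin (α i)) E := fun i => Matrix.of fun p q =>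
    ⟨(ι i * π i) p q, IntermediateField.subset_adjoin _ _ ⟨⟨i, p, q⟩, rfl⟩⟩
  have hε : ∀ i, (ε i).map (algebraMap E k) = ι i * π i := fun _ => rfl
  have hinj : ∀ m n : ℕ, Function.Injective
      fun M : Matrix (Fin m) (Fin n) E => M.map (algebraMap E k) :=
    fun m n => Matrix.map_injective (algebraMap E k).injective
  have hεε : ∀ i, ε i * ε i = ε i := fun i => by
    apply hinj
    simp only [Matrix.map_mul, hε]
    rw [Matrix.mul_assoc, ← Matrix.mul_assoc (π i), h1, Matrix.one_mul]
  have hxε : ∀ a, (x a).map (algebraMap F E) * ε (src a) =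
      ε (tgt a) * (x a).map (algebraMap F E) := fun a => by
    apply hinj
    have hx : ((x a).map (algebraMap F E)).map (algebraMap E k) =
      baseChange src tgt (algebraMap F k) x a := rfl
    simp only [Matrix.map_mul, hε, hx]
    rw [← Matrix.mul_assoc, h2, Matrix.mul_assoc, h3, Matrix.mul_assoc]
  obtain ⟨ζ, hζ⟩ := FiniteField.unitsMap_norm_surjective F E c
  have hcomm : ∀ (t : E) (a : Ω), (x a).map (algebraMap F E) * (1 + t • ε (src a)) =
      (1 + t • ε (tgt a)) * (x a).map (algebraMap F E) := fun t a => by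
    rw [Matrix.mul_add, Matrix.add_mul, Matrix.mul_smul, Matrix.smul_mul, hxε, Matrix.mul_one,
      Matrix.one_mul]
  have hdet : ∀ i, (1 + ((ζ : E) - 1) • ε i).det = (ζ : E) ^ β i := fun i => by
    apply (algebraMap E k).injective
    have h4 : (1 + ((ζ : E) - 1) • ε i).map (algebraMap E k) =
        1 + (((ζ : E) : k) - 1) • ι i * π i := by
      rw [Matrix.smul_mul, ← hε]
      ext p q
      by_cases hpq : p = q <;> simp [hpq, IntermediateField.algebraMap_apply]
    rw [RingHom.map_det]
    change ((1 + ((ζ : E) - 1) • ε i).map (algebraMap E k)).det = _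
    rw [h4, Matrix.det_one_add_mul_comm, Matrix.mul_smul, h1,
      show (1 : Matrix (Fin (β i)) (Fin (β i)) k) + (((ζ : E) : k) - 1) • 1 = ((ζ : E) : k) • 1 by
        rw [sub_smul, one_smul, add_sub_cancel], Matrix.det_smul]
    simp [IntermediateField.algebraMap_apply]
  obtain ⟨g, hg, hgdet⟩ := exists_glAct_eq_self_det_eq_norm x (hcomm ((ζ : E) - 1))
    (hcomm (((ζ⁻¹ : Eˣ) : E) - 1)) fun i => by
      have hζ' : (((ζ⁻¹ : Eˣ) : E) - 1) + ((ζ : E) - 1) +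
          (((ζ⁻¹ : Eˣ) : E) - 1) * ((ζ : E) - 1) = 0 := by
        linear_combination ζ.inv_mul
      calc (1 + (((ζ⁻¹ : Eˣ) : E) - 1) • ε i) * (1 + ((ζ : E) - 1) • ε i)
          = 1 + ((((ζ⁻¹ : Eˣ) : E) - 1) + ((ζ : E) - 1) +
          (((ζ⁻¹ : Eˣ) : E) - 1) * ((ζ : E) - 1)) • ε i := by
            rw [Matrix.add_mul, Matrix.mul_add, Matrix.mul_add, smul_mul_smul_comm, hεε,
              Matrix.one_mul, Matrix.one_mul, Matrix.mul_one, add_smul, add_smul]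
            abel
        _ = 1 := by rw [hζ', zero_smul, add_zero]
  refine ⟨g, hg, fun i => Units.ext ?_⟩
  rw [hgdet, hdet, map_pow, ← hζ]
  rfl

/-- If `σ ^ β = 1` for all direct summands of `x ⊗ k`, then the character given by `σ` is trivial
on the stabilizer of `x`. -/
theorem prod_character_det_eq_one [Fintype I] [Fintype F] [IsAlgClosed k] [Algebra F k]
    {α : I → ℕ} {x : Rep src tgt F α} {σ : I → (Fˣ →* ℂˣ)}
    (h : ∀ (β : I → ℕ) (W : Rep src tgt k β),
      IsRetract src tgt W (baseChange src tgt (algebraMap F k) x) → ∏ i, σ i ^ β i = 1)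
    {g : ∀ i, GL (Fin (α i)) F} (hg : glAct src tgt g x = x) :
    ∏ i, σ i (Matrix.GeneralLinearGroup.det (g i)) = 1 := by
  obtain ⟨τ, hτ, hσ⟩ := FiniteField.exists_monoidHom_pow_eq F
  choose n hn using fun i => hσ (σ i)
  have hdet : ∏ i, (g i : Matrix (Fin (α i)) (Fin (α i)) F).det ^ n i = 1 := by
    refine FiniteField.prod_det_pow_eq_one (k := k) _
      (fun i => (Matrix.GeneralLinearGroup.det (g i)).ne_zero) n fun μ => ?_
    obtain ⟨W, hW⟩ := exists_isRetract_rootMultiplicity (baseChange src tgt (algebraMap F k) x)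
      (fun i => (g i : Matrix (Fin (α i)) (Fin (α i)) F).map (algebraMap F k)) (fun a => by
        have := congrArg (fun M => M.map (algebraMap F k)) ((glAct_eq_self_iff g x).1 hg a)
        simp only [Matrix.map_mul] at this
        exact this) μ
    rw [← hτ, orderOf_dvd_iff_pow_eq_one, ← Finset.prod_pow_eq_pow_sum, ← h _ W hW]
    exact Finset.prod_congr rfl fun i _ => by rw [hn, pow_mul]
  calc ∏ i, σ i (Matrix.GeneralLinearGroup.det (g i))
      = τ (∏ i, Matrix.GeneralLinearGroup.det (g i) ^ n i) := by
        rw [map_prod]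
        exact Finset.prod_congr rfl fun i _ => by rw [hn, MonoidHom.pow_apply, map_pow]
    _ = 1 := by
        rw [show ∏ i, Matrix.GeneralLinearGroup.det (g i) ^ n i = 1 from
          Units.ext (by simpa using hdet), map_one]

end QRep

open QRep in
/-- For a finite quiver `Q`, a finite field `𝔽_q`, `α ∈ ℕ^I` and a tuple
`σ` of characters `𝔽_q^× → ℂ^×`, with `ρ((g_i)) = ∏ σ_i(det g_i)`: for every
representation `x ∈ R(Q,α)(𝔽_q)`, `ρ` is trivial on the stabilizer of `x` iff every
indecomposable direct summand `Y` of `x ⊗ 𝔽̄_q` satisfies `σ^{dim Y} = 1`. -/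
theorem statement3 (I Ω : Type) [Fintype I] [Fintype Ω] (src tgt : Ω → I)
    (F : Type) [Field F] [Fintype F] (α : I → ℕ) (σ : I → (Fˣ →* ℂˣ))
    (x : Rep src tgt F α) :
    (∀ g : ∀ i, GL (Fin (α i)) F, glAct src tgt g x = x →
        ∏ i, σ i (Matrix.GeneralLinearGroup.det (g i)) = 1) ↔
    (∀ (β δ : I → ℕ) (Y : Rep src tgt (AlgebraicClosure F) β)
        (z : Rep src tgt (AlgebraicClosure F) δ),
        Indec src tgt Y →
        RepIso src tgt (baseChange src tgt (algebraMap F (AlgebraicClosure F)) x)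
          (dsum src tgt Y z) →
        ∏ i, (σ i) ^ (β i) = 1) := by
  constructor
  · intro h β δ Y z _ hiso
    ext c : 1
    obtain ⟨g, hg, hdet⟩ :=
      ((isRetract_dsum_left Y z).trans hiso.isRetract).exists_glAct_eq_self c
    simpa [hdet, MonoidHom.finsetProd_apply] using h g hg
  · intro h g hg
    refine prod_character_det_eq_one (k := AlgebraicClosure F) (fun β W hW => ?_) hg
    refine hW.induction_indec (p := fun β => ∏ i, σ i ^ β i = 1)
      (Finset.prod_eq_one fun i _ => pow_zero (σ i)) (fun β γ hβ hγ => ?_) h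
    refine (Finset.prod_congr rfl fun i _ => pow_add (σ i) (β i) (γ i)).trans ?_
    rw [Finset.prod_mul_distrib, hβ, hγ]
    exact one_mul (1 : Fˣ →* ℂˣ)
end

section
/- Let Q = (I, Ω) be a finite quiver, q a prime power, α ∈ ℕ^I, and σ = (σ_i)_{i∈I} a tuple of group homomorphisms σ_i : 𝔽_q^× → ℂ^×; write σ^δ = ∏_{i∈I} σ_i^{δ_i} for δ ∈ ℕ^I and ρ((g_i)_{i∈I}) = ∏_{i∈I} σ_i(det g_i). Then (1/|GL_α(𝔽_q)|) · Σ_{g ∈ GL_α(𝔽_q)} #{x ∈ R(Q,α)(𝔽_q) : g·x = x} · ρ(g) equals the number of GL_α(𝔽_q)-orbits of representations x ∈ R(Q,α)(𝔽_q) such that every indecomposable direct summand Y of x ⊗ 𝔽̄_q satisfies σ^{dim Y} = 1. -/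
open Matrix

namespace QRep
variable {I Ω : Type} {src tgt : Ω → I}

/-- The general linear group of a dimension vector acts on representations. -/
@[reducible] noncomputable def glMulAction (src tgt : Ω → I) (K : Type) [Field K] (β : I → ℕ) :
    MulAction (∀ i, GL (Fin (β i)) K) (Rep src tgt K β) where
  smul := glAct src tgt
  one_smul x := by
    funext a
    change glAct src tgt 1 x a = x a
    simp [glAct]
  mul_smul g h x := by
    funext a
    change glAct src tgt (g * h) x a = glAct src tgt g (glAct src tgt h x) a
    simp only [glAct, Pi.mul_apply, _root_.mul_inv_rev, Units.val_mul, Matrix.mul_assoc]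

end QRep

/-- A linear character averaged against a permutation character counts the orbits whose
stabilizers lie in the kernel of the linear character. -/
theorem average_card_fixedBy_mul_character {G X : Type} [Group G] [Finite G] [MulAction G X]
    [Finite X] (χ : G →* ℂˣ) :
    (Nat.card G : ℂ)⁻¹ * ∑ᶠ g : G, (Nat.card {x : X // g • x = x} : ℂ) * (χ g : ℂ) =
      (Nat.card (Quot fun x y : {x : X // ∀ g : G, g • x = x → χ g = 1} =>
        ∃ g : G, g • x.1 = y.1) : ℂ) := by
  classical
  have := Fintype.ofFinite G
  have := Fintype.ofFinite X
  let S : Set X := {x : X | ∀ g : G, g • x = x → χ g = 1}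
  let act : MulAction G {x : X // ∀ g : G, g • x = x → χ g = 1} :=
    { smul := fun g x => ⟨g • x.1, fun h hh => by
        have h1 := x.2 (g⁻¹ * h * g) (by rw [mul_smul, mul_smul, hh, inv_smul_smul])
        simpa [mul_comm, mul_assoc] using h1⟩
      one_smul := fun x => Subtype.ext (one_smul G x.1)
      mul_smul := fun g h x => Subtype.ext (mul_smul g h x.1) }
  have hact : ∀ (g : G) (x : {x : X // ∀ g : G, g • x = x → χ g = 1}), (g • x).1 = g • x.1 :=
    fun _ _ => rfl
  have hburn := MulAction.sum_card_fixedBy_eq_card_orbits_mul_card_group G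
    {x : X // ∀ g : G, g • x = x → χ g = 1}
  have hquot : Nat.card (Quot fun x y : {x : X // ∀ g : G, g • x = x → χ g = 1} =>
        ∃ g : G, g • x.1 = y.1) =
      Fintype.card (Quotient (MulAction.orbitRel G {x : X // ∀ g : G, g • x = x → χ g = 1})) := by
    rw [← Nat.card_eq_fintype_card]
    refine Nat.card_congr (Quot.congrRight fun x y => ?_)
    rw [MulAction.orbitRel_apply, MulAction.mem_orbit_symm, MulAction.mem_orbit_iff]
    simp only [Subtype.ext_iff, hact]
  rw [hquot, inv_mul_eq_iff_eq_mul₀ (by simp), mul_comm, Nat.card_eq_fintype_card, ← Nat.cast_mul,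
    ← hburn, finsum_eq_sum_of_fintype]
  have hstab : ∀ x : X, (∑ g : G, if g • x = x then (χ g : ℂ) else 0) =
      ∑ g : G, if g • x = x ∧ x ∈ S then (1 : ℂ) else 0 := by
    intro x
    by_cases hx : x ∈ S
    · refine Finset.sum_congr rfl fun g _ => ?_
      by_cases hg : g • x = x
      · simp [hg, hx, hx g hg]
      · simp [hg]
    · simp only [hx, and_false, if_false, Finset.sum_const_zero]
      obtain ⟨h, hh, hχ⟩ : ∃ h : G, h • x = x ∧ χ h ≠ 1 := by
        simpa [S] using hx
      have hs : (∑ g : G, if g • x = x then (χ g : ℂ) else 0) =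
          (χ h : ℂ) * ∑ g : G, if g • x = x then (χ g : ℂ) else 0 := by
        rw [Finset.mul_sum, ← Equiv.sum_comp (Equiv.mulLeft h)]
        refine Finset.sum_congr rfl fun g _ => ?_
        have : (h * g) • x = x ↔ g • x = x := by
          rw [mul_smul]
          constructor
          · intro hg
            exact smul_left_cancel h (hg.trans hh.symm)
          · intro hg
            rw [hg, hh]
        simp [this]
      have hne : (χ h : ℂ) - 1 ≠ 0 := by
        rw [sub_ne_zero]
        exact fun h1 => hχ (Units.ext h1)
      have : ((χ h : ℂ) - 1) * (∑ g : G, if g • x = x then (χ g : ℂ) else 0) = 0 := by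
        rw [sub_mul, one_mul, ← hs, sub_self]
      exact (mul_eq_zero.1 this).resolve_left hne
  calc ∑ g : G, (Nat.card {x : X // g • x = x} : ℂ) * (χ g : ℂ)
      = ∑ g : G, ∑ x : X, if g • x = x then (χ g : ℂ) else 0 := by
        refine Finset.sum_congr rfl fun g _ => ?_
        rw [← Finset.sum_filter, Finset.sum_const, nsmul_eq_mul, Nat.card_eq_fintype_card,
          Fintype.card_subtype]
    _ = ∑ x : X, ∑ g : G, if g • x = x ∧ x ∈ S then (1 : ℂ) else 0 := by
        rw [Finset.sum_comm]
        exact Finset.sum_congr rfl fun x _ => hstab x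
    _ = _ := by
        rw [Finset.sum_comm]
        push_cast
        refine Finset.sum_congr rfl fun g _ => ?_
        rw [← Finset.sum_filter, Finset.sum_const, nsmul_eq_mul, mul_one, ← Fintype.card_subtype]
        congr 1
        refine Fintype.card_congr ⟨fun x => ⟨⟨x.1, x.2.2⟩, Subtype.ext x.2.1⟩,
          fun x => ⟨x.1.1, congrArg Subtype.val x.2, x.1.2⟩, fun _ => rfl, fun _ => rfl⟩

section Cancellation

variable {R : Type} [Ring R]

/-- Linear maps with kernel `N` are injective linear maps out of the quotient by `N`. -/
def linearMapKerEquiv (X M : Type) [AddCommGroup X] [Module R X] [AddCommGroup M] [Module R M]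
    (N : Submodule R X) :
    {f : X →ₗ[R] M // LinearMap.ker f = N} ≃ {f : (X ⧸ N) →ₗ[R] M // LinearMap.ker f = ⊥} where
  toFun f := ⟨N.liftQ f.1 f.2.ge, Submodule.ker_liftQ_eq_bot _ _ _ f.2.le⟩
  invFun f := ⟨f.1.comp N.mkQ, by rw [LinearMap.ker_comp, f.2]; exact N.ker_mkQ⟩
  left_inv f := Subtype.ext (N.liftQ_mkQ f.1 f.2.ge)
  right_inv f := Subtype.ext (by ext; simp)

theorem card_linearMap_eq_sum_ker (X M : Type) [AddCommGroup X] [Module R X] [AddCommGroup M]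
    [Module R M] [Finite X] [Finite M] [Fintype (Submodule R X)] :
    Nat.card (X →ₗ[R] M) =
      ∑ N : Submodule R X, Nat.card {f : X →ₗ[R] M // LinearMap.ker f = N} := by
  have : Finite (X →ₗ[R] M) := DFunLike.finite _
  rw [← Nat.card_sigma]
  exact (Nat.card_congr (Equiv.sigmaFiberEquiv (LinearMap.ker (R := R) (M := X) (M₂ := M)))).symm

/-- If two finite modules receive equally many linear maps from every finite module, they receive
equally many injective linear maps from every finite module. -/
theorem card_injective_linearMap_eq (M N : Type) [AddCommGroup M] [Module R M] [Finite M]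
    [AddCommGroup N] [Module R N] [Finite N]
    (h : ∀ (X : Type) [AddCommGroup X] [Module R X] [Finite X],
      Nat.card (X →ₗ[R] M) = Nat.card (X →ₗ[R] N)) :
    ∀ (n : ℕ) (X : Type) [AddCommGroup X] [Module R X] [Finite X], Nat.card X = n →
      Nat.card {f : X →ₗ[R] M // LinearMap.ker f = ⊥} =
        Nat.card {f : X →ₗ[R] N // LinearMap.ker f = ⊥} := by
  classical
  intro n
  induction n using Nat.strong_induction_on with
  | _ n ih =>
    intro X _ _ _ hX
    have : Finite (Submodule R X) := Finite.of_injective _ SetLike.coe_injective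
    have := Fintype.ofFinite (Submodule R X)
    have key := h X
    rw [card_linearMap_eq_sum_ker, card_linearMap_eq_sum_ker,
      ← Finset.add_sum_erase _ _ (Finset.mem_univ (⊥ : Submodule R X)),
      ← Finset.add_sum_erase _ _ (Finset.mem_univ (⊥ : Submodule R X))] at key
    rw [Finset.sum_congr rfl (g := fun K => Nat.card {f : X →ₗ[R] N // LinearMap.ker f = K})] at key
    · exact Nat.add_right_cancel key
    · intro K hK
      have hK : K ≠ ⊥ := (Finset.mem_erase.1 hK).1
      rw [Nat.card_congr (linearMapKerEquiv X M K), Nat.card_congr (linearMapKerEquiv X N K)]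
      have : Finite (X ⧸ K) := Finite.of_surjective _ K.mkQ_surjective
      refine ih (Nat.card (X ⧸ K)) ?_ _ rfl
      have h1 := K.card_eq_card_quotient_mul_card
      have h2 : 1 < Nat.card K := by
        have := (Submodule.nontrivial_iff_ne_bot (p := K)).2 hK
        exact Finite.one_lt_card
      have h3 : 0 < Nat.card (X ⧸ K) := Nat.card_pos
      rw [← hX, h1]
      nlinarith

theorem nonempty_linearEquiv_of_card_linearMap_eq (M N : Type) [AddCommGroup M] [Module R M]
    [Finite M] [AddCommGroup N] [Module R N] [Finite N]
    (h : ∀ (X : Type) [AddCommGroup X] [Module R X] [Finite X],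
      Nat.card (X →ₗ[R] M) = Nat.card (X →ₗ[R] N)) : Nonempty (M ≃ₗ[R] N) := by
  have : Finite (M →ₗ[R] N) := DFunLike.finite _
  have : Finite (M →ₗ[R] M) := DFunLike.finite _
  have : Finite (N →ₗ[R] M) := DFunLike.finite _
  have : Finite (N →ₗ[R] N) := DFunLike.finite _
  obtain ⟨f, hf⟩ : Nonempty {f : M →ₗ[R] N // LinearMap.ker f = ⊥} := by
    refine (Nat.card_pos_iff.1 ?_).1
    rw [← card_injective_linearMap_eq M N h _ M rfl]
    have : Nonempty {f : M →ₗ[R] M // LinearMap.ker f = ⊥} := ⟨LinearMap.id, LinearMap.ker_id⟩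
    exact Nat.card_pos
  obtain ⟨g, hg⟩ : Nonempty {f : N →ₗ[R] M // LinearMap.ker f = ⊥} := by
    refine (Nat.card_pos_iff.1 ?_).1
    rw [card_injective_linearMap_eq M N h _ N rfl]
    have : Nonempty {f : N →ₗ[R] N // LinearMap.ker f = ⊥} := ⟨LinearMap.id, LinearMap.ker_id⟩
    exact Nat.card_pos
  have hfi := LinearMap.ker_eq_bot.1 hf
  have hgi := LinearMap.ker_eq_bot.1 hg
  refine ⟨LinearEquiv.ofBijective f ?_⟩
  exact (Nat.bijective_iff_injective_and_card f).2
    ⟨hfi, le_antisymm (Nat.card_le_card_of_injective f hfi) (Nat.card_le_card_of_injective g hgi)⟩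

/-- Finite modules with isomorphic powers are isomorphic. -/
theorem nonempty_linearEquiv_of_pi {ι : Type} [Finite ι] [Nonempty ι] (M N : Type)
    [AddCommGroup M] [Module R M] [Finite M] [AddCommGroup N] [Module R N] [Finite N]
    (e : (ι → M) ≃ₗ[R] (ι → N)) : Nonempty (M ≃ₗ[R] N) := by
  refine nonempty_linearEquiv_of_card_linearMap_eq M N fun X _ _ _ => ?_
  have hpow : ∀ (P : Type) [AddCommGroup P] [Module R P],
      Nat.card (X →ₗ[R] (ι → P)) = Nat.card (X →ₗ[R] P) ^ Nat.card ι := by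
    intro P _ _
    rw [← Nat.card_fun]
    exact Nat.card_congr ⟨fun f k => (LinearMap.proj k).comp f, fun f => LinearMap.pi f,
      fun f => by ext; rfl, fun f => by ext; rfl⟩
  have hcongr : Nat.card (X →ₗ[R] (ι → M)) = Nat.card (X →ₗ[R] (ι → N)) :=
    Nat.card_congr ⟨fun f => e.toLinearMap.comp f, fun f => e.symm.toLinearMap.comp f,
      fun f => by ext; simp, fun f => by ext; simp⟩
  rw [hpow, hpow] at hcongr
  exact Nat.pow_left_injective Nat.card_pos.ne' hcongr

end Cancellation

/-- Finite-dimensional vector spaces with operators over a finite field are isomorphic if they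
become isomorphic after passing to direct powers. -/
theorem exists_linearEquiv_commuting_of_pi {F T ι : Type} [Field F] [Finite ι] [Nonempty ι]
    {V W : Type} [AddCommGroup V] [Module F V] [Finite V] [AddCommGroup W] [Module F W] [Finite W]
    (t : T → Module.End F V) (s : T → Module.End F W) (e : (ι → V) ≃ₗ[F] (ι → W))
    (he : ∀ a v, e (fun k => t a (v k)) = fun k => s a (e v k)) :
    ∃ f : V ≃ₗ[F] W, ∀ a v, f (t a v) = s a (f v) := by
  let : Module (FreeAlgebra F T) V := Module.compHom V (FreeAlgebra.lift F t).toRingHom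
  let : Module (FreeAlgebra F T) W := Module.compHom W (FreeAlgebra.lift F s).toRingHom
  have hV : ∀ (r : FreeAlgebra F T) (v : V), r • v = FreeAlgebra.lift F t r v := fun _ _ => rfl
  have hW : ∀ (r : FreeAlgebra F T) (w : W), r • w = FreeAlgebra.lift F s r w := fun _ _ => rfl
  have hsmul : ∀ (r : FreeAlgebra F T) (v : ι → V), e (r • v) = r • e v := by
    intro r
    induction r using FreeAlgebra.induction with
    | grade0 c =>
      intro v
      have h1 : (algebraMap F (FreeAlgebra F T) c) • v = c • v := by
        ext k; simp [hV]
      have h2 : (algebraMap F (FreeAlgebra F T) c) • e v = c • e v := by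
        ext k; simp [hW]
      rw [h1, h2, map_smul]
    | grade1 a =>
      intro v
      have h1 : FreeAlgebra.ι F a • v = fun k => t a (v k) := by
        ext k; simp [hV]
      rw [h1, he]
      ext k; simp [hW]
    | mul r r' h h' => intro v; rw [mul_smul, h, h', mul_smul]
    | add r r' h h' => intro v; rw [add_smul, map_add, h, h', add_smul]
  obtain ⟨f⟩ := nonempty_linearEquiv_of_pi (R := FreeAlgebra F T) (ι := ι) V W
    { e.toAddEquiv with map_smul' := hsmul }
  refine ⟨{ f.toAddEquiv with map_smul' := fun c v => ?_ }, fun a v => ?_⟩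
  · have h := f.map_smul (algebraMap F (FreeAlgebra F T) c) v
    simpa [hV, hW] using h
  · have h := f.map_smul (FreeAlgebra.ι F a) v
    simpa [hV, hW] using h

namespace QRep

variable {I Ω : Type} {src tgt : Ω → I}

/-- The operators on the total space of a representation: the projections to the vertices and the
arrows. -/
noncomputable def totalOp {F : Type} [Field F] {α : I → ℕ} (x : Rep src tgt F α)
    (L : Type) [AddCommGroup L] [Module F L] :
    I ⊕ Ω → Module.End F (∀ i, Fin (α i) → L) := by
  classical
  exact Sum.elim (fun i => (LinearMap.single F (fun i => Fin (α i) → L) i).comp (LinearMap.proj i))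
    (fun a => (LinearMap.single F (fun i => Fin (α i) → L) (tgt a)).comp
      ((LinearMap.pi fun j => ∑ k, x a j k • LinearMap.proj k).comp (LinearMap.proj (src a))))

theorem totalOp_inl [DecidableEq I] {F : Type} [Field F] {α : I → ℕ} (x : Rep src tgt F α)
    (L : Type) [AddCommGroup L] [Module F L] (i : I) (v : ∀ i, Fin (α i) → L) :
    totalOp x L (Sum.inl i) v = Pi.single i (v i) := by
  simp only [totalOp, Sum.elim_inl, LinearMap.comp_apply, LinearMap.proj_apply,
    LinearMap.single_apply]
  congr!

theorem totalOp_inr [DecidableEq I] {F : Type} [Field F] {α : I → ℕ} (x : Rep src tgt F α)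
    (L : Type) [AddCommGroup L] [Module F L] (a : Ω) (v : ∀ i, Fin (α i) → L) :
    totalOp x L (Sum.inr a) v = Pi.single (tgt a) (fun j => ∑ k, x a j k • v (src a) k) := by
  simp only [totalOp, Sum.elim_inr, LinearMap.comp_apply, LinearMap.proj_apply,
    LinearMap.single_apply]
  have : (LinearMap.pi fun j => ∑ k, x a j k • LinearMap.proj (R := F) (φ := fun _ => L) k) (v (src a)) =
      fun j => ∑ k, x a j k • v (src a) k := by
    ext j; simp
  rw [this]
  congr!

/-- Representations over a finite field that become isomorphic over a finite extension are
isomorphic. -/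
theorem exists_gl_of_finite_extension [Finite I] {F L : Type} [Field F] [Finite F] [Field L]
    [Algebra F L] [FiniteDimensional F L] {α : I → ℕ} (x y : Rep src tgt F α)
    (P : ∀ i, Matrix (Fin (α i)) (Fin (α i)) L) (hP : ∀ i, IsUnit (P i))
    (h : ∀ a, P (tgt a) * (x a).map (algebraMap F L) = (y a).map (algebraMap F L) * P (src a)) :
    ∃ Q : ∀ i, GL (Fin (α i)) F, ∀ a,
      (Q (tgt a) : Matrix (Fin (α (tgt a))) (Fin (α (tgt a))) F) * x a =
        y a * (Q (src a) : Matrix (Fin (α (src a))) (Fin (α (src a))) F) := by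
  classical
  let b := Module.finBasis F L
  have : Nonempty (Fin (Module.finrank F L)) := Fin.pos_iff_nonempty.1 Module.finrank_pos
  let c : (Fin (Module.finrank F L) → ∀ i, Fin (α i) → F) ≃ₗ[F] (∀ i, Fin (α i) → L) :=
    { toFun := fun v i j => b.equivFun.symm fun k => v k i j
      invFun := fun w k i j => b.equivFun (w i j) k
      left_inv := fun v => by
        ext k i j
        exact congrFun (b.equivFun.apply_symm_apply fun k => v k i j) k
      right_inv := fun w => by
        ext i j
        exact b.equivFun.symm_apply_apply (w i j)
      map_add' := fun v w => by
        ext i j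
        exact map_add b.equivFun.symm (fun k => v k i j) (fun k => w k i j)
      map_smul' := fun r v => by
        ext i j
        exact map_smul b.equivFun.symm r (fun k => v k i j) }
  have hc : ∀ (z : Rep src tgt F α) (t : I ⊕ Ω) v,
      c (fun k => totalOp z F t (v k)) = totalOp z L t (c v) := by
    intro z t v
    ext i j
    rcases t with i' | a
    · change b.equivFun.symm (fun k => totalOp z F _ (v k) i j) = _
      simp only [totalOp_inl]
      rcases eq_or_ne i i' with rfl | hi
      · simp only [Pi.single_eq_same]; rfl
      · simp only [Pi.single_eq_of_ne hi, Pi.zero_apply]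
        exact map_zero b.equivFun.symm
    · change b.equivFun.symm (fun k => totalOp z F _ (v k) i j) = _
      simp only [totalOp_inr]
      rcases eq_or_ne i (tgt a) with rfl | hi
      · simp only [Pi.single_eq_same]
        have : (fun k => ∑ l, z a j l • v k (src a) l) = ∑ l, z a j l • fun k => v k (src a) l := by
          ext k; simp
        rw [this, map_sum]
        refine Finset.sum_congr rfl fun l _ => ?_
        rw [map_smul]
        rfl
      · simp only [Pi.single_eq_of_ne hi, Pi.zero_apply]
        exact map_zero b.equivFun.symm
  let p : (∀ i, Fin (α i) → L) ≃ₗ[F] (∀ i, Fin (α i) → L) :=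
    { toFun := fun v i => P i *ᵥ v i
      invFun := fun v i => (P i)⁻¹ *ᵥ v i
      left_inv := fun v => by
        ext1 i
        simp [Matrix.mulVec_mulVec, Matrix.nonsing_inv_mul _ ((P i).isUnit_iff_isUnit_det.1 (hP i))]
      right_inv := fun v => by
        ext1 i
        simp [Matrix.mulVec_mulVec, Matrix.mul_nonsing_inv _ ((P i).isUnit_iff_isUnit_det.1 (hP i))]
      map_add' := fun v w => by
        ext1 i
        exact Matrix.mulVec_add _ _ _
      map_smul' := fun r v => by
        ext1 i
        exact Matrix.mulVec_smul (P i) r (v i) }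
  have hp : ∀ t v, p (totalOp x L t v) = totalOp y L t (p v) := by
    intro t v
    ext1 i
    change P i *ᵥ (totalOp x L t v i) = _
    rcases t with i' | a
    · simp only [totalOp_inl]
      rcases eq_or_ne i i' with rfl | hi
      · simp only [Pi.single_eq_same]; rfl
      · simp only [Pi.single_eq_of_ne hi, Matrix.mulVec_zero]
    · simp only [totalOp_inr]
      rcases eq_or_ne i (tgt a) with rfl | hi
      · simp only [Pi.single_eq_same]
        have hz : ∀ (z : Rep src tgt F α) (w : Fin (α (src a)) → L),
            (fun j => ∑ k, z a j k • w k) = (z a).map (algebraMap F L) *ᵥ w := by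
          intro z w
          ext j
          simp [Matrix.mulVec, dotProduct, Algebra.smul_def]
        rw [hz, hz, Matrix.mulVec_mulVec, h a, ← Matrix.mulVec_mulVec]
        rfl
      · simp only [Pi.single_eq_of_ne hi, Matrix.mulVec_zero]
  obtain ⟨f, hf⟩ := exists_linearEquiv_commuting_of_pi (totalOp x F) (totalOp y F)
    ((c.trans p).trans c.symm) (fun t v => by
      apply c.injective
      rw [hc]
      simp [hc, hp])
  have hf' : ∀ t v, f.symm (totalOp y F t v) = totalOp x F t (f.symm v) := fun t v => by
    rw [LinearEquiv.symm_apply_eq, hf, LinearEquiv.apply_symm_apply]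
  let q : ∀ i, (Fin (α i) → F) →ₗ[F] (Fin (α i) → F) := fun i =>
    ((LinearMap.proj i).comp f.toLinearMap).comp (LinearMap.single F (fun i => Fin (α i) → F) i)
  let q' : ∀ i, (Fin (α i) → F) →ₗ[F] (Fin (α i) → F) := fun i =>
    ((LinearMap.proj i).comp f.symm.toLinearMap).comp
      (LinearMap.single F (fun i => Fin (α i) → F) i)
  have hq : ∀ i v, f (Pi.single i v) = Pi.single i (q i v) := fun i v => by
    have := hf (Sum.inl i) (Pi.single i v)
    rw [totalOp_inl, totalOp_inl, Pi.single_eq_same] at this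
    exact this
  have hq' : ∀ i v, f.symm (Pi.single i v) = Pi.single i (q' i v) := fun i v => by
    have := hf' (Sum.inl i) (Pi.single i v)
    rw [totalOp_inl, totalOp_inl, Pi.single_eq_same] at this
    exact this
  have hqq' : ∀ i, q i ∘ₗ q' i = LinearMap.id := fun i => by
    refine LinearMap.ext fun v => Pi.single_injective (M := fun i => Fin (α i) → F) i ?_
    rw [LinearMap.comp_apply, ← hq, ← hq', LinearEquiv.apply_symm_apply, LinearMap.id_apply]
  have hq'q : ∀ i, q' i ∘ₗ q i = LinearMap.id := fun i => by
    refine LinearMap.ext fun v => Pi.single_injective (M := fun i => Fin (α i) → F) i ?_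
    rw [LinearMap.comp_apply, ← hq', ← hq, LinearEquiv.symm_apply_apply, LinearMap.id_apply]
  refine ⟨fun i => ⟨(q i).toMatrix', (q' i).toMatrix', ?_, ?_⟩, fun a => ?_⟩
  · rw [← LinearMap.toMatrix'_comp, hqq', LinearMap.toMatrix'_id]
  · rw [← LinearMap.toMatrix'_comp, hq'q, LinearMap.toMatrix'_id]
  · apply Matrix.toLin'.injective
    rw [Matrix.toLin'_mul, Matrix.toLin'_mul, Matrix.toLin'_toMatrix', Matrix.toLin'_toMatrix']
    refine LinearMap.ext fun v => Pi.single_injective (M := fun i => Fin (α i) → F) (tgt a) ?_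
    have := hf (Sum.inr a) (Pi.single (src a) v)
    rw [totalOp_inr, totalOp_inr, hq, hq, Pi.single_eq_same, Pi.single_eq_same] at this
    exact this

/-- Representations over a finite field that become isomorphic over an algebraic extension are
isomorphic. -/
theorem exists_gl_of_algebraic_extension [Finite I] {F E : Type} [Field F] [Finite F] [Field E]
    [Algebra F E] [Algebra.IsAlgebraic F E] {α : I → ℕ} (x y : Rep src tgt F α)
    (P : ∀ i, Matrix (Fin (α i)) (Fin (α i)) E) (hP : ∀ i, IsUnit (P i))
    (h : ∀ a, P (tgt a) * (x a).map (algebraMap F E) = (y a).map (algebraMap F E) * P (src a)) :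
    ∃ Q : ∀ i, GL (Fin (α i)) F, ∀ a,
      (Q (tgt a) : Matrix (Fin (α (tgt a))) (Fin (α (tgt a))) F) * x a =
        y a * (Q (src a) : Matrix (Fin (α (src a))) (Fin (α (src a))) F) := by
  let S : Set E := Set.range fun p : (i : I) × Fin (α i) × Fin (α i) => P p.1 p.2.1 p.2.2
  have : Finite S := (Set.finite_range _).to_subtype
  have : FiniteDimensional F (IntermediateField.adjoin F S) :=
    IntermediateField.finiteDimensional_adjoin
      fun x _ => (Algebra.IsAlgebraic.isAlgebraic x).isIntegral
  have hinj : Function.Injective (algebraMap (IntermediateField.adjoin F S) E) :=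
    (algebraMap (IntermediateField.adjoin F S) E).injective
  let P' : ∀ i, Matrix (Fin (α i)) (Fin (α i)) (IntermediateField.adjoin F S) := fun i =>
    Matrix.of fun j k => ⟨P i j k, IntermediateField.subset_adjoin F S ⟨⟨i, j, k⟩, rfl⟩⟩
  have hP' : ∀ i, (P' i).map (algebraMap (IntermediateField.adjoin F S) E) = P i := fun i => rfl
  have hmap : ∀ (z : Rep src tgt F α) a,
      ((z a).map (algebraMap F (IntermediateField.adjoin F S))).map
        (algebraMap (IntermediateField.adjoin F S) E) = (z a).map (algebraMap F E) :=
    fun z a => rfl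
  refine exists_gl_of_finite_extension x y P' (fun i => ?_) (fun a => ?_)
  · rw [Matrix.isUnit_iff_isUnit_det, isUnit_iff_ne_zero]
    intro h0
    have h1 := (Matrix.isUnit_iff_isUnit_det _).1 (hP i)
    rw [← hP' i, ← RingHom.mapMatrix_apply, ← RingHom.map_det, h0, map_zero] at h1
    exact not_isUnit_zero h1
  · refine Matrix.map_injective hinj ?_
    exact (Matrix.map_mul (f := algebraMap (IntermediateField.adjoin F S) E)).trans
      ((h a).trans (Matrix.map_mul (L := (y a).map (algebraMap F (IntermediateField.adjoin F S)))
        (M := P' (src a)) (f := algebraMap (IntermediateField.adjoin F S) E)).symm)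

end QRep

section Frobenius

open Polynomial

variable {F E : Type} [Field F] [Fintype F] [Field E] [Algebra F E]

theorem exists_pos_frobenius_iterate_eq [Algebra.IsAlgebraic F E] (s : Set E) (hs : s.Finite) :
    ∃ n : ℕ, 0 < n ∧ ∀ c ∈ s, c ^ Fintype.card F ^ n = c := by
  have : FiniteDimensional F (IntermediateField.adjoin F s) := by
    have := hs.to_subtype
    exact IntermediateField.finiteDimensional_adjoin
      fun x _ => (Algebra.IsAlgebraic.isAlgebraic x).isIntegral
  have : Finite (IntermediateField.adjoin F s) := Module.finite_of_finite F
  have := Fintype.ofFinite (IntermediateField.adjoin F s)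
  refine ⟨Module.finrank F (IntermediateField.adjoin F s), Module.finrank_pos, fun c hc => ?_⟩
  have h := FiniteField.pow_card
    (⟨c, IntermediateField.subset_adjoin F s hc⟩ : IntermediateField.adjoin F s)
  rw [Module.card_eq_pow_finrank (K := F)] at h
  exact congrArg Subtype.val h

theorem frobenius_iterate_apply (n : ℕ) (c : E) :
    (FiniteField.frobeniusAlgHom F E)^[n] c = c ^ Fintype.card F ^ n := by
  induction n with
  | zero => simp
  | succ n ih =>
    rw [Function.iterate_succ_apply', ih, FiniteField.coe_frobeniusAlgHom, pow_succ, pow_mul]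

theorem exists_finset_card_eq_frobenius_fixed [IsAlgClosed E] (n : ℕ) (hn : n ≠ 0) :
    ∃ s : Finset E, s.card = Fintype.card F ^ n ∧ ∀ c ∈ s, c ^ Fintype.card F ^ n = c := by
  classical
  obtain ⟨p, hp⟩ := CharP.exists F
  have : CharP E p := charP_of_injective_algebraMap (algebraMap F E).injective p
  have hdvd : p ∣ Fintype.card F := by
    rw [← CharP.cast_eq_zero_iff F p]
    exact FiniteField.cast_card_eq_zero F
  have hsep : (X ^ (Fintype.card F ^ n) - X : E[X]).Separable :=
    galois_poly_separable p _ (dvd_pow hdvd hn)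
  refine ⟨(X ^ (Fintype.card F ^ n) - X : E[X]).roots.toFinset, ?_, fun c hc => ?_⟩
  · rw [Multiset.toFinset_card_of_nodup (nodup_roots hsep),
      ← (IsAlgClosed.splits _).natDegree_eq_card_roots,
      FiniteField.X_pow_card_pow_sub_X_natDegree_eq _ hn Fintype.one_lt_card]
  · have := (mem_roots'.1 (Multiset.mem_toFinset.1 hc)).2
    simpa [IsRoot, sub_eq_zero] using this

theorem mem_range_algebraMap_of_pow_card_eq [IsAlgClosed E] {c : E}
    (hc : c ^ Fintype.card F = c) : ∃ a : F, algebraMap F E a = c := by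
  classical
  by_contra! h
  have key := Polynomial.card_roots' (X ^ Fintype.card F - X : E[X])
  rw [FiniteField.X_pow_card_sub_X_natDegree_eq _ Fintype.one_lt_card] at key
  have hne : (X ^ Fintype.card F - X : E[X]) ≠ 0 :=
    FiniteField.X_pow_card_sub_X_ne_zero _ Fintype.one_lt_card
  have hsub : insert c (Finset.univ.image (algebraMap F E)) ⊆
      (X ^ Fintype.card F - X : E[X]).roots.toFinset := by
    intro d hd
    rw [Multiset.mem_toFinset, mem_roots hne]
    rcases Finset.mem_insert.1 hd with rfl | hd
    · simp [IsRoot, hc]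
    · obtain ⟨a, -, rfl⟩ := Finset.mem_image.1 hd
      simp [IsRoot, ← map_pow, FiniteField.pow_card]
  have h1 := Finset.card_le_card hsub
  rw [Finset.card_insert_of_notMem (by simpa using h),
    Finset.card_image_of_injective _ (algebraMap F E).injective, Finset.card_univ] at h1
  have h2 := Multiset.toFinset_card_le (X ^ Fintype.card F - X : E[X]).roots
  omega

/-- Lang's theorem for the general linear group. -/
theorem exists_isUnit_map_frobenius_eq_mul [IsAlgClosed E] [Algebra.IsAlgebraic F E]
    {m : Type} [Fintype m] [DecidableEq m] (g : Matrix m m E) (hg : IsUnit g) :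
    ∃ P : Matrix m m E, IsUnit P ∧ P.map (FiniteField.frobeniusAlgHom F E) = P * g := by
  set φ := FiniteField.frobeniusAlgHom F E with hφ
  have hφinj : Function.Injective φ := φ.toRingHom.injective
  have hgdet : IsUnit g.det := (Matrix.isUnit_iff_isUnit_det g).1 hg
  let Φ : (m → E) → (m → E) := fun v => (φ ∘ v) ᵥ* g⁻¹
  have hΦadd : ∀ v w, Φ (v + w) = Φ v + Φ w := fun v w => by
    have : φ ∘ (v + w) = φ ∘ v + φ ∘ w := by ext; simp
    simp only [Φ, this, Matrix.add_vecMul]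
  have hΦsmul : ∀ (c : E) v, Φ (c • v) = φ c • Φ v := fun c v => by
    have : φ ∘ (c • v) = φ c • (φ ∘ v) := by ext; simp
    simp only [Φ, this, Matrix.smul_vecMul]
  have hΦinj : Function.Injective Φ := by
    intro v w h
    have h' := congrArg (fun u => u ᵥ* g) h
    simp only [Φ, Matrix.vecMul_vecMul, Matrix.nonsing_inv_mul g hgdet, Matrix.vecMul_one] at h'
    exact hφinj.comp_left h'
  have hΦsum : ∀ (r : ℕ) (u : ℕ → m → E), Φ (∑ k ∈ Finset.range r, u k) =
      ∑ k ∈ Finset.range r, Φ (u k) := fun r u =>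
    map_sum (AddMonoidHom.mk' Φ hΦadd) u _
  have hper : ∀ v, ∃ r, 0 < r ∧ Φ^[r] v = v := by
    intro v
    obtain ⟨n, hn, hfix⟩ := exists_pos_frobenius_iterate_eq (F := F)
      (Set.range v ∪ Set.range fun p : m × m => g⁻¹ p.1 p.2)
      ((Set.finite_range _).union (Set.finite_range _))
    let B : Set (m → E) := {u | ∀ i, φ^[n] (u i) = u i}
    have hB : B.Finite := by
      have : B = Set.pi Set.univ fun _ => {c : E | φ^[n] c = c} := by
        ext u; simp [B]
      rw [this]
      refine Set.Finite.pi fun _ => ?_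
      have hne : (X ^ (Fintype.card F ^ n) - X : E[X]) ≠ 0 :=
        FiniteField.X_pow_card_pow_sub_X_ne_zero _ hn.ne' Fintype.one_lt_card
      refine (Polynomial.finite_setOfPred_isRoot hne).subset fun c hc => ?_
      simpa [IsRoot, sub_eq_zero, ← frobenius_iterate_apply (F := F)] using hc
    have hφn : ∀ c : E, φ^[n] c = (φ ^ n) c := fun c => by
      rw [AlgHom.coe_pow]
    have hmaps : Set.MapsTo Φ B B := by
      intro u hu j
      simp only [B, Set.mem_ofPred_eq, hφn] at hu ⊢
      simp only [Φ, Matrix.vecMul, dotProduct, map_sum, map_mul, Function.comp_apply]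
      refine Finset.sum_congr rfl fun i _ => ?_
      have h1 : (φ ^ n) (φ (u i)) = φ ((φ ^ n) (u i)) := by
        rw [← AlgHom.mul_apply, ← AlgHom.mul_apply, (Commute.refl φ).pow_left n |>.eq]
      rw [h1, hu, ← hφn, frobenius_iterate_apply, hfix _ (Or.inr ⟨(i, j), rfl⟩)]
    have hv : v ∈ B := fun i => by
      rw [frobenius_iterate_apply, hfix _ (Or.inl ⟨i, rfl⟩)]
    have hiter : ∀ k, Φ^[k] v ∈ B := fun k => hmaps.iterate k hv
    obtain ⟨a, -, b, -, hab, heq⟩ := Set.infinite_univ.exists_ne_map_eq_of_mapsTo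
      (f := fun k => Φ^[k] v) (t := B) (fun k _ => hiter k) hB
    wlog hlt : a < b generalizing a b
    · exact this b a hab.symm heq.symm (lt_of_le_of_ne (not_lt.1 hlt) hab.symm)
    refine ⟨b - a, Nat.sub_pos_of_lt hlt, ?_⟩
    have heq' : Φ^[a] v = Φ^[a] (Φ^[b - a] v) := by
      rw [← Function.iterate_add_apply, Nat.add_sub_cancel' hlt.le]
      exact heq
    exact (hΦinj.iterate a heq').symm
  have hspan : ⊤ ≤ Submodule.span E {v | Φ v = v} := by
    by_contra hnot
    obtain ⟨l, hl0, hl⟩ := Submodule.exists_le_ker_of_lt_top _ (lt_top_iff_ne_top.2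
      fun h => hnot h.ge)
    refine hl0 (LinearMap.ext fun v => ?_)
    obtain ⟨r, hr, hv⟩ := hper v
    have hiter : ∀ (k : ℕ) (c : E), Φ^[k] (c • v) = φ^[k] c • Φ^[k] v := by
      intro k c
      induction k with
      | zero => rfl
      | succ k ih => rw [Function.iterate_succ_apply', ih, hΦsmul, ← Function.iterate_succ_apply' φ,
          ← Function.iterate_succ_apply' Φ]
    obtain ⟨s, hscard, hs⟩ := exists_finset_card_eq_frobenius_fixed (F := F) (E := E) r hr.ne'
    let f : E[X] := ∑ k ∈ Finset.range r, C (l (Φ^[k] v)) * X ^ (Fintype.card F ^ k)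
    have hq : 1 < Fintype.card F := Fintype.one_lt_card
    have hf : f = 0 := by
      refine eq_zero_of_natDegree_lt_card_of_eval_eq_zero' f s (fun c hc => ?_) ?_
      · have hw : ∑ k ∈ Finset.range r, Φ^[k] (c • v) ∈ Submodule.span E {v | Φ v = v} := by
          refine Submodule.subset_span ?_
          change Φ _ = _
          rw [hΦsum]
          simp only [← Function.iterate_succ_apply' Φ]
          have h1 := Finset.sum_range_succ (fun k => Φ^[k] (c • v)) r
          rw [Finset.sum_range_succ'] at h1
          have h2 : Φ^[r] (c • v) = Φ^[0] (c • v) := by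
            rw [hiter, hv, frobenius_iterate_apply, hs c hc]; rfl
          rw [h2] at h1
          exact add_right_cancel h1
        have h3 := hl hw
        rw [LinearMap.mem_ker, map_sum] at h3
        rw [← h3]
        simp only [f, eval_finsetSum, eval_mul, eval_C, eval_pow, eval_X]
        refine Finset.sum_congr rfl fun k _ => ?_
        rw [hiter, map_smul, frobenius_iterate_apply, smul_eq_mul, mul_comm]
      · rw [hscard]
        refine lt_of_le_of_lt (natDegree_sum_le_of_forall_le (n := Fintype.card F ^ (r - 1)) _ _
          fun k hk => (natDegree_C_mul_X_pow_le _ _).trans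
            (Nat.pow_le_pow_right hq.le (Nat.le_sub_one_of_lt (Finset.mem_range.1 hk)))) ?_
        exact Nat.pow_lt_pow_right hq (Nat.sub_lt hr one_pos)
    have hcoeff : f.coeff 1 = l v := by
      simp only [f, finsetSum_coeff, coeff_C_mul, coeff_X_pow]
      rw [Finset.sum_eq_single 0]
      · simp
      · intro k _ hk
        rw [if_neg (Nat.one_lt_pow hk hq).ne, mul_zero]
      · intro h0
        exact absurd (Finset.mem_range.2 hr) h0
    rw [← hcoeff, hf, coeff_zero, LinearMap.zero_apply]
  let b := Module.Basis.ofSpan hspan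
  let b' := b.reindex (b.indexEquiv (Pi.basisFun E m))
  refine ⟨Matrix.of fun i => b' i, ?_, ?_⟩
  · exact Matrix.linearIndependent_rows_iff_isUnit.1 b'.linearIndependent
  · ext i j
    have hmem : Φ (b' i) = b' i := by
      have := Module.Basis.ofSpan_subset hspan
      exact this ⟨_, (b.reindex_apply _ i).symm⟩
    have h' := congrArg (fun u => u ᵥ* g) hmem
    simp only [Φ, Matrix.vecMul_vecMul, Matrix.nonsing_inv_mul g hgdet, Matrix.vecMul_one] at h'
    exact congrFun h' j

end Frobenius

namespace QRep

variable {I Ω : Type} {src tgt : Ω → I}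

theorem eq_of_mul_eq_mul_of_isUnit {K m n : Type} [Field K] [Fintype n] [DecidableEq n]
    {M N : Matrix m n K} {U : Matrix n n K} (hU : IsUnit U) (h : M * U = N * U) : M = N := by
  have hdet := (Matrix.isUnit_iff_isUnit_det _).1 hU
  rw [← Matrix.mul_nonsing_inv_cancel_right U M hdet, h,
    Matrix.mul_nonsing_inv_cancel_right U N hdet]

theorem mul_units_inv_eq_iff {K m n : Type} [Field K] [Fintype n] [DecidableEq n]
    (M N : Matrix m n K) (u : GL n K) :
    M * ((u⁻¹ : GL n K) : Matrix n n K) = N ↔ M = N * (u : Matrix n n K) := by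
  constructor
  · rintro rfl
    rw [Matrix.mul_assoc, u.inv_mul, Matrix.mul_one]
  · rintro rfl
    rw [Matrix.mul_assoc, u.mul_inv, Matrix.mul_one]

theorem glAct_eq_iff {K : Type} [Field K] {β : I → ℕ} (g : ∀ i, GL (Fin (β i)) K)
    (x y : Rep src tgt K β) :
    glAct src tgt g x = y ↔ ∀ a,
      (g (tgt a) : Matrix (Fin (β (tgt a))) (Fin (β (tgt a))) K) * x a =
        y a * (g (src a) : Matrix (Fin (β (src a))) (Fin (β (src a))) K) :=
  (funext_iff (f := glAct src tgt g x) (g := y)).trans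
    (forall_congr' fun a => mul_units_inv_eq_iff (_ * x a) (y a) (g (src a)))

theorem exists_matrix_map_algebraMap_eq {F E : Type} [Field F] [Fintype F] [Field E] [Algebra F E]
    [IsAlgClosed E] {m n : Type} (M : Matrix m n E)
    (hM : M.map (FiniteField.frobeniusAlgHom F E) = M) :
    ∃ M₀ : Matrix m n F, M₀.map (algebraMap F E) = M := by
  have : ∀ i j, ∃ c : F, algebraMap F E c = M i j := fun i j =>
    mem_range_algebraMap_of_pow_card_eq (congrFun (congrFun hM i) j)
  choose f hf using this
  exact ⟨Matrix.of f, by ext i j; exact hf i j⟩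

theorem map_algebraMap_map_algHom {F E : Type} [Field F] [Field E] [Algebra F E]
    {m n : Type} (M : Matrix m n F) (ψ : E →ₐ[F] E) :
    (M.map (algebraMap F E)).map ψ = M.map (algebraMap F E) := by
  ext i j
  simp

/-- Lang's theorem for the automorphism group of a representation. -/
theorem exists_automorphism_map_frobenius_eq_mul [Finite I] {F E : Type} [Field F] [Fintype F]
    [Field E] [Algebra F E] [IsAlgClosed E] [Algebra.IsAlgebraic F E] {α : I → ℕ}
    (x : Rep src tgt F α) (g : ∀ i, Matrix (Fin (α i)) (Fin (α i)) E) (hg : ∀ i, IsUnit (g i))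
    (h : ∀ a, g (tgt a) * (x a).map (algebraMap F E) = (x a).map (algebraMap F E) * g (src a)) :
    ∃ P : ∀ i, Matrix (Fin (α i)) (Fin (α i)) E, (∀ i, IsUnit (P i)) ∧
      (∀ a, P (tgt a) * (x a).map (algebraMap F E) = (x a).map (algebraMap F E) * P (src a)) ∧
      ∀ i, (P i).map (FiniteField.frobeniusAlgHom F E) = P i * g i := by
  choose P hP hPg using fun i => exists_isUnit_map_frobenius_eq_mul (F := F) (g i) (hg i)
  let X : ∀ a, Matrix (Fin (α (tgt a))) (Fin (α (src a))) E := fun a => (x a).map (algebraMap F E)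
  have hX : ∀ a, g (tgt a) * X a = X a * g (src a) := h
  have hXφ : ∀ a, (X a).map (FiniteField.frobeniusAlgHom F E) = X a := fun a =>
    map_algebraMap_map_algHom _ _
  have hPdet : ∀ i, IsUnit (P i).det := fun i => (Matrix.isUnit_iff_isUnit_det _).1 (hP i)
  have hy : ∀ a, ∃ y : Matrix (Fin (α (tgt a))) (Fin (α (src a))) F,
      y.map (algebraMap F E) = P (tgt a) * X a * (P (src a))⁻¹ := by
    intro a
    apply exists_matrix_map_algebraMap_eq
    have h1 : (P (tgt a) * X a * (P (src a))⁻¹).map (FiniteField.frobeniusAlgHom F E) *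
        (P (src a) * g (src a)) = P (tgt a) * X a * (P (src a))⁻¹ * (P (src a) * g (src a)) := by
      rw [← hPg (src a), ← Matrix.map_mul, Matrix.mul_assoc, Matrix.nonsing_inv_mul _ (hPdet _),
        Matrix.mul_one, Matrix.map_mul, hPg, hPg, hXφ, Matrix.mul_assoc, hX,
        Matrix.mul_assoc (P _ * X a), ← Matrix.mul_assoc (P (src a))⁻¹,
        Matrix.nonsing_inv_mul _ (hPdet _), Matrix.one_mul, Matrix.mul_assoc]
    exact eq_of_mul_eq_mul_of_isUnit ((hP (src a)).mul (hg (src a))) h1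
  choose y hy using hy
  have hPy : ∀ a, P (tgt a) * X a = (y a).map (algebraMap F E) * P (src a) := fun a => by
    rw [hy, Matrix.mul_assoc, Matrix.nonsing_inv_mul _ (hPdet _), Matrix.mul_one]
  obtain ⟨Q, hQ⟩ := exists_gl_of_algebraic_extension x y P hP hPy
  let R : ∀ i, Matrix (Fin (α i)) (Fin (α i)) E := fun i =>
    ((Q i)⁻¹ : GL (Fin (α i)) F).val.map (algebraMap F E)
  let Q' : ∀ i, Matrix (Fin (α i)) (Fin (α i)) E := fun i => (Q i).val.map (algebraMap F E)
  have hRQ : ∀ i, R i * Q' i = 1 := fun i => by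
    rw [← Matrix.map_mul, Units.inv_mul, Matrix.map_one _ (map_zero _) (map_one _)]
  have hQR : ∀ i, Q' i * R i = 1 := fun i => by
    rw [← Matrix.map_mul, Units.mul_inv, Matrix.map_one _ (map_zero _) (map_one _)]
  have hQ' : ∀ a, Q' (tgt a) * X a = (y a).map (algebraMap F E) * Q' (src a) := fun a => by
    have := congrArg (fun M => M.map (algebraMap F E)) (hQ a)
    exact (Matrix.map_mul (f := algebraMap F E)).symm.trans
      (this.trans (Matrix.map_mul (f := algebraMap F E)))
  refine ⟨fun i => R i * P i, fun i => ?_, fun a => ?_, fun i => ?_⟩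
  · exact (IsUnit.of_mul_eq_one _ (hRQ i)).mul (hP i)
  · change R (tgt a) * P (tgt a) * X a = X a * (R (src a) * P (src a))
    have h1 : R (tgt a) * (y a).map (algebraMap F E) = X a * R (src a) := by
      calc R (tgt a) * (y a).map (algebraMap F E)
          = R (tgt a) * ((y a).map (algebraMap F E) * Q' (src a)) * R (src a) := by
            rw [Matrix.mul_assoc, Matrix.mul_assoc, hQR, Matrix.mul_one]
        _ = _ := by rw [← hQ', ← Matrix.mul_assoc, hRQ, Matrix.one_mul]
    rw [Matrix.mul_assoc, hPy, ← Matrix.mul_assoc, h1, Matrix.mul_assoc]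
  · rw [Matrix.map_mul, hPg, map_algebraMap_map_algHom, Matrix.mul_assoc]

theorem levelAtMost_of_character_eq_one [Fintype I] {F : Type} [Field F] [Fintype F] {α : I → ℕ}
    (x : Rep src tgt F α) (σ : I → (Fˣ →* ℂˣ))
    (hx : ∀ g : ∀ i, GL (Fin (α i)) F, glAct src tgt g x = x →
      ∏ i, σ i (Matrix.GeneralLinearGroup.det (g i)) = 1) :
    LevelAtMost src tgt x {δ | ∏ i, (σ i) ^ (δ i) = 1} := by
  intro γ δ Y z _ ⟨e, he⟩
  let E := AlgebraicClosure F
  let φ := FiniteField.frobeniusAlgHom F E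
  let X : ∀ a, Matrix (Fin (α (tgt a))) (Fin (α (src a))) E := fun a => (x a).map (algebraMap F E)
  let Z : ∀ a, Matrix (Fin ((γ + δ) (tgt a))) (Fin ((γ + δ) (src a))) E := dsum src tgt Y z
  let S : ∀ i, Matrix (Fin ((γ + δ) i)) (Fin (α i)) E := fun i => (e i).toLinearMap.toMatrix'
  let S' : ∀ i, Matrix (Fin (α i)) (Fin ((γ + δ) i)) E := fun i =>
    (e i).symm.toLinearMap.toMatrix'
  have hSS' : ∀ i, S i * S' i = 1 := fun i => by
    rw [← LinearMap.toMatrix'_comp, LinearEquiv.comp_symm, LinearMap.toMatrix'_id]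
  have hS'S : ∀ i, S' i * S i = 1 := fun i => by
    rw [← LinearMap.toMatrix'_comp, LinearEquiv.symm_comp, LinearMap.toMatrix'_id]
  have hS : ∀ a, Z a * S (src a) = S (tgt a) * X a := fun a => by
    apply Matrix.toLin'.injective
    rw [Matrix.toLin'_mul, Matrix.toLin'_mul, Matrix.toLin'_toMatrix', Matrix.toLin'_toMatrix']
    exact he a
  have hS' : ∀ a, S' (tgt a) * Z a = X a * S' (src a) := fun a => by
    rw [← Matrix.mul_one (S' (tgt a) * Z a), ← hSS' (src a), Matrix.mul_assoc,
      ← Matrix.mul_assoc (Z a), hS, Matrix.mul_assoc (S (tgt a)), ← Matrix.mul_assoc, hS'S,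
      Matrix.one_mul]
  let D : E → ∀ i, Matrix (Fin ((γ + δ) i)) (Fin ((γ + δ) i)) E := fun μ i =>
    Matrix.reindex finSumFinEquiv finSumFinEquiv
      (Matrix.fromBlocks (μ • (1 : Matrix (Fin (γ i)) (Fin (γ i)) E)) 0 0 1)
  have hDdet : ∀ μ i, (D μ i).det = μ ^ γ i := fun μ i => by
    simp [D]
  have hDZ : ∀ μ a, D μ (tgt a) * Z a = Z a * D μ (src a) := fun μ a => by
    simp only [D, Z, dsum, Matrix.reindex_apply, Matrix.submatrix_mul_equiv,
      Matrix.fromBlocks_multiply]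
    simp
  obtain ⟨n, hn, hfix⟩ := exists_pos_frobenius_iterate_eq (F := F) (E := E)
    ((Set.range fun p : (i : I) × Fin ((γ + δ) i) × Fin (α i) => S p.1 p.2.1 p.2.2) ∪
      Set.range fun p : (i : I) × Fin (α i) × Fin ((γ + δ) i) => S' p.1 p.2.1 p.2.2)
    ((Set.finite_range _).union (Set.finite_range _))
  let ψ : E →ₐ[F] E := φ ^ n
  have hψ : ∀ c, ψ c = c ^ Fintype.card F ^ n := fun c => by
    rw [← frobenius_iterate_apply, AlgHom.coe_pow]
  have hψS : ∀ i, (S i).map ψ = S i := fun i => by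
    ext j k
    rw [Matrix.map_apply, hψ, hfix _ (Or.inl ⟨⟨i, j, k⟩, rfl⟩)]
  have hψS' : ∀ i, (S' i).map ψ = S' i := fun i => by
    ext j k
    rw [Matrix.map_apply, hψ, hfix _ (Or.inr ⟨⟨i, j, k⟩, rfl⟩)]
  have hψD : ∀ μ i, (D μ i).map ψ = D (ψ μ) i := fun μ i => by
    ext j k
    simp only [D, Matrix.reindex_apply, Matrix.map_apply, Matrix.submatrix_apply]
    rcases finSumFinEquiv.symm j with j' | j' <;> rcases finSumFinEquiv.symm k with k' | k' <;>
      simp only [Matrix.fromBlocks_apply₁₁, Matrix.fromBlocks_apply₁₂, Matrix.fromBlocks_apply₂₁,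
        Matrix.fromBlocks_apply₂₂, Matrix.smul_apply, Matrix.zero_apply, Matrix.one_apply,
        smul_eq_mul, map_zero, apply_ite ψ, map_one, mul_ite, mul_one, mul_zero]
  change ∏ i, (σ i) ^ (γ i) = 1
  ext1 l
  obtain ⟨q, hq⟩ : ∃ q, Fintype.card F = q + 1 := ⟨_, (Nat.succ_pred Fintype.card_ne_zero).symm⟩
  let N := ∑ k ∈ Finset.range n, Fintype.card F ^ k
  have hN : N * q + 1 = Fintype.card F ^ n := by
    simpa [N, hq] using geom_sum_mul_add q n
  have hNpos : 0 < N :=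
    Finset.sum_pos (fun k _ => pow_pos Fintype.card_pos k) ⟨0, Finset.mem_range.2 hn⟩
  obtain ⟨μ, hμ⟩ := IsAlgClosed.exists_pow_nat_eq (algebraMap F E l) hNpos
  have hlq : (l : F) ^ q = 1 := by
    have := FiniteField.pow_card_sub_one_eq_one (l : F) l.ne_zero
    rwa [hq] at this
  have hψμ : ψ μ = μ := by
    rw [hψ, ← hN, pow_succ, pow_mul, hμ, ← map_pow, hlq, map_one, one_mul]
  have hμ0 : μ ≠ 0 := by
    rintro rfl
    rw [zero_pow hNpos.ne'] at hμ
    exact l.ne_zero ((algebraMap F E).injective (by rw [map_zero, hμ]))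
  let g : ∀ i, Matrix (Fin (α i)) (Fin (α i)) E := fun i => S' i * D μ i * S i
  have hgdet : ∀ i, (g i).det = μ ^ γ i := fun i => by
    rw [← hDdet]
    exact Matrix.det_conj_of_mul_eq_one (hS'S i) (hSS' i)
  have hgunit : ∀ i, IsUnit (g i) := fun i => by
    rw [Matrix.isUnit_iff_isUnit_det, hgdet]
    exact (isUnit_iff_ne_zero.2 hμ0).pow _
  have hgX : ∀ a, g (tgt a) * X a = X a * g (src a) := fun a => by
    simp only [g]
    rw [Matrix.mul_assoc, ← hS, ← Matrix.mul_assoc, Matrix.mul_assoc (S' _), hDZ,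
      ← Matrix.mul_assoc, hS', Matrix.mul_assoc, Matrix.mul_assoc, Matrix.mul_assoc]
  have hψg : ∀ i, (g i).map ψ = g i := fun i => by
    simp only [g]
    rw [Matrix.map_mul, Matrix.map_mul, hψS, hψS', hψD, hψμ]
  obtain ⟨P, hP, hPX, hPg⟩ := exists_automorphism_map_frobenius_eq_mul x g hgunit hgX
  have hPdet : ∀ i, IsUnit (P i).det := fun i => (Matrix.isUnit_iff_isUnit_det _).1 (hP i)
  have hcomm : ∀ c, φ (ψ c) = ψ (φ c) := fun c => by
    rw [← AlgHom.mul_apply, ← AlgHom.mul_apply, ((Commute.refl φ).pow_right n).eq]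
  have hH : ∀ i, ∃ H : Matrix (Fin (α i)) (Fin (α i)) F,
      H.map (algebraMap F E) = (P i).map ψ * (P i)⁻¹ := by
    intro i
    apply exists_matrix_map_algebraMap_eq
    refine eq_of_mul_eq_mul_of_isUnit ((hP i).mul (hgunit i)) ?_
    have h1 : ((P i).map ψ).map φ = (P i).map ψ * g i := by
      have : ((P i).map ψ).map φ = ((P i).map φ).map ψ := by
        ext j k; simp [hcomm]
      rw [this, hPg, Matrix.map_mul, hψg]
    rw [← hPg, ← Matrix.map_mul, Matrix.mul_assoc, Matrix.nonsing_inv_mul _ (hPdet i),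
      Matrix.mul_one, hPg, ← Matrix.mul_assoc, Matrix.nonsing_inv_mul_cancel_right _ _ (hPdet i)]
    exact h1
  choose H hH using hH
  have hdet : ∀ i, (H i).det = (l : F) ^ γ i := by
    intro i
    apply (algebraMap F E).injective
    rw [RingHom.map_det, RingHom.mapMatrix_apply, hH, Matrix.det_mul, map_pow, ← hμ]
    have hφdet : φ (P i).det = (P i).det * μ ^ γ i := by
      rw [← hgdet, ← Matrix.det_mul, ← hPg]
      exact AlgHom.map_det φ (P i)
    have hiter : ∀ k, (P i).det ^ Fintype.card F ^ k =
        (P i).det * (μ ^ γ i) ^ ∑ k ∈ Finset.range k, Fintype.card F ^ k := by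
      intro k
      induction k with
      | zero => simp
      | succ k ih =>
        have h1 : (P i).det ^ Fintype.card F = (P i).det * μ ^ γ i := hφdet
        rw [pow_succ', pow_mul, h1, mul_pow, ih, Finset.sum_range_succ, pow_add, mul_assoc]
    have hψdet : ((P i).map ψ).det = (P i).det * (μ ^ γ i) ^ N := by
      rw [← hiter, ← hψ]
      exact (AlgHom.map_det ψ (P i)).symm
    rw [hψdet, mul_right_comm, ← Matrix.det_mul, Matrix.mul_nonsing_inv _ (hPdet i),
      Matrix.det_one, one_mul, ← pow_mul, ← pow_mul, mul_comm]
  have hHunit : ∀ i, IsUnit (H i).det := fun i => by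
    rw [hdet]
    exact l.isUnit.pow _
  let h : ∀ i, GL (Fin (α i)) F := fun i => Matrix.GeneralLinearGroup.mk'' (H i) (hHunit i)
  have hh := hx h ((glAct_eq_iff _ _ _).2 fun a => by
    apply Matrix.map_injective (algebraMap F E).injective
    have h1 : (P (tgt a)).map ψ * X a = X a * (P (src a)).map ψ := by
      have := congrArg (fun M => M.map ψ) (hPX a)
      simp only [Matrix.map_mul, map_algebraMap_map_algHom] at this
      exact this
    have h2 : (P (tgt a))⁻¹ * X a = X a * (P (src a))⁻¹ := by
      refine eq_of_mul_eq_mul_of_isUnit (hP (src a)) ?_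
      rw [Matrix.nonsing_inv_mul_cancel_right _ _ (hPdet _), Matrix.mul_assoc, ← hPX,
        Matrix.nonsing_inv_mul_cancel_left _ _ (hPdet _)]
    refine (Matrix.map_mul (L := H (tgt a)) (M := x a) (f := algebraMap F E)).trans
      (Eq.trans ?_ (Matrix.map_mul (L := x a) (M := H (src a)) (f := algebraMap F E)).symm)
    rw [hH, hH]
    change _ * X a = X a * _
    rw [Matrix.mul_assoc, h2, ← Matrix.mul_assoc, h1, Matrix.mul_assoc])
  have hdet' : ∀ i, Matrix.GeneralLinearGroup.det (h i) = l ^ γ i := fun i => by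
    ext
    rw [Units.val_pow_eq_pow_val, ← hdet]
    rfl
  simp only [hdet', map_pow] at hh
  rw [MonoidHom.one_apply, MonoidHom.finsetProd_apply, ← hh]
  simp

end QRep

namespace QRep

variable {I Ω : Type} {src tgt : Ω → I}

/-- `Y` is a direct summand of `x`, expressed by an inclusion with a retraction. -/
def IsSummand {K : Type} [Field K] {β γ : I → ℕ} (x : Rep src tgt K β) (Y : Rep src tgt K γ) :
    Prop :=
  ∃ (A : ∀ i, (Fin (γ i) → K) →ₗ[K] (Fin (β i) → K))
    (B : ∀ i, (Fin (β i) → K) →ₗ[K] (Fin (γ i) → K)),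
    (∀ i v, B i (A i v) = v) ∧ (∀ a v, x a *ᵥ A (src a) v = A (tgt a) (Y a *ᵥ v)) ∧
      ∀ a v, Y a *ᵥ B (src a) v = B (tgt a) (x a *ᵥ v)

theorem IsSummand.refl {K : Type} [Field K] {β : I → ℕ} (x : Rep src tgt K β) : IsSummand x x :=
  ⟨fun _ => LinearMap.id, fun _ => LinearMap.id, fun _ _ => rfl, fun _ _ => rfl, fun _ _ => rfl⟩

theorem IsSummand.trans {K : Type} [Field K] {β γ δ : I → ℕ} {x : Rep src tgt K β}
    {y : Rep src tgt K γ} {z : Rep src tgt K δ} (hxy : IsSummand x y) (hyz : IsSummand y z) :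
    IsSummand x z := by
  obtain ⟨A, B, h, hA, hB⟩ := hxy
  obtain ⟨A', B', h', hA', hB'⟩ := hyz
  refine ⟨fun i => A i ∘ₗ A' i, fun i => B' i ∘ₗ B i, fun i v => ?_, fun a v => ?_, fun a v => ?_⟩
  · simp [h, h']
  · simp [hA, hA']
  · simp [hB, hB']

/-- Splitting a column vector of length `m + n` into its two blocks. -/
noncomputable def finAddEquivProd (K : Type) [Field K] (m n : ℕ) :
    (Fin (m + n) → K) ≃ₗ[K] (Fin m → K) × (Fin n → K) :=
  (LinearEquiv.funCongrLeft K K finSumFinEquiv).trans (LinearEquiv.sumArrowLequivProdArrow _ _ K K)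

theorem dsum_mulVec_symm {K : Type} [Field K] {γ δ : I → ℕ} (y : Rep src tgt K γ)
    (z : Rep src tgt K δ) (a : Ω) (v : Fin (γ (src a)) → K) (w : Fin (δ (src a)) → K) :
    dsum src tgt y z a *ᵥ (finAddEquivProd K (γ (src a)) (δ (src a))).symm (v, w) =
      (finAddEquivProd K (γ (tgt a)) (δ (tgt a))).symm (y a *ᵥ v, z a *ᵥ w) := by
  have h : ∀ (m n : ℕ) (v : Fin m → K) (w : Fin n → K),
      (finAddEquivProd K m n).symm (v, w) = Sum.elim v w ∘ finSumFinEquiv.symm := by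
    intro m n v w
    rw [LinearEquiv.symm_apply_eq]
    ext j <;> simp [finAddEquivProd, LinearEquiv.funCongrLeft, LinearMap.funLeft]
  rw [h, h]
  change (Matrix.reindex finSumFinEquiv finSumFinEquiv _) *ᵥ _ = _
  rw [Matrix.reindex_apply, Matrix.submatrix_mulVec_equiv]
  simp only [Equiv.symm_symm, Function.comp_assoc, Equiv.symm_comp_self, Function.comp_id]
  rw [Matrix.fromBlocks_mulVec]
  simp

theorem repIso_iff {K : Type} [Field K] {β γ : I → ℕ} {x : Rep src tgt K β}
    {y : Rep src tgt K γ} : RepIso src tgt x y ↔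
      ∃ e : ∀ i, (Fin (β i) → K) ≃ₗ[K] (Fin (γ i) → K),
        ∀ a v, y a *ᵥ e (src a) v = e (tgt a) (x a *ᵥ v) := by
  refine exists_congr fun e => forall_congr' fun a => ?_
  rw [LinearMap.ext_iff]
  rfl

theorem IsSummand.of_repIso_dsum {K : Type} [Field K] {β γ δ : I → ℕ} {x : Rep src tgt K β}
    {y : Rep src tgt K γ} {z : Rep src tgt K δ} (h : RepIso src tgt x (dsum src tgt y z)) :
    IsSummand x y ∧ IsSummand x z := by
  obtain ⟨e, he⟩ := repIso_iff.1 h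
  have he' : ∀ a v, x a *ᵥ (e (src a)).symm v = (e (tgt a)).symm (dsum src tgt y z a *ᵥ v) := by
    intro a v
    rw [LinearEquiv.eq_symm_apply, ← he, LinearEquiv.apply_symm_apply]
  let J : ∀ i, (Fin ((γ + δ) i) → K) ≃ₗ[K] (Fin (γ i) → K) × (Fin (δ i) → K) := fun i =>
    finAddEquivProd K (γ i) (δ i)
  have hJ : ∀ a v, J (tgt a) (dsum src tgt y z a *ᵥ v) =
      (y a *ᵥ (J (src a) v).1, z a *ᵥ (J (src a) v).2) := by
    intro a v
    rw [← LinearEquiv.eq_symm_apply]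
    conv_lhs => rw [← (J (src a)).symm_apply_apply v]
    exact dsum_mulVec_symm y z a _ _
  have hJ' : ∀ a v w, dsum src tgt y z a *ᵥ (J (src a)).symm (v, w) =
      (J (tgt a)).symm (y a *ᵥ v, z a *ᵥ w) := dsum_mulVec_symm y z
  refine ⟨⟨fun i => (e i).symm.toLinearMap ∘ₗ (J i).symm.toLinearMap ∘ₗ LinearMap.inl K _ _,
    fun i => LinearMap.fst K _ _ ∘ₗ (J i).toLinearMap ∘ₗ (e i).toLinearMap, ?_, ?_, ?_⟩,
    ⟨fun i => (e i).symm.toLinearMap ∘ₗ (J i).symm.toLinearMap ∘ₗ LinearMap.inr K _ _,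
    fun i => LinearMap.snd K _ _ ∘ₗ (J i).toLinearMap ∘ₗ (e i).toLinearMap, ?_, ?_, ?_⟩⟩
  · intro i v
    simp
  · intro a v
    simp [he', hJ']
  · intro a v
    simp [← he, hJ]
  · intro i v
    simp
  · intro a v
    simp [he', hJ']
  · intro a v
    simp [← he, hJ]

/-- Two complementary families of subspaces, stable under a representation, decompose it. -/
theorem exists_isSummand_of_isCompl {K : Type} [Field K] {β : I → ℕ} (x : Rep src tgt K β)
    (U W : ∀ i, Submodule K (Fin (β i) → K)) (hUW : ∀ i, IsCompl (U i) (W i))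
    (hU : ∀ a, ∀ v ∈ U (src a), x a *ᵥ v ∈ U (tgt a))
    (hW : ∀ a, ∀ v ∈ W (src a), x a *ᵥ v ∈ W (tgt a)) :
    ∃ y : Rep src tgt K fun i => Module.finrank K (U i), IsSummand x y := by
  let b : ∀ i, U i ≃ₗ[K] (Fin (Module.finrank K (U i)) → K) := fun i =>
    (Module.finBasis K (U i)).equivFun
  let r : ∀ a, U (src a) →ₗ[K] U (tgt a) := fun a => (x a).mulVecLin.restrict (hU a)
  let p : ∀ i, (Fin (β i) → K) →ₗ[K] U i := fun i => (U i).projectionOnto (W i) (hUW i)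
  let Y : ∀ a, Matrix (Fin (Module.finrank K (U (tgt a)))) (Fin (Module.finrank K (U (src a)))) K :=
    fun a => LinearMap.toMatrix' ((b (tgt a)).toLinearMap ∘ₗ r a ∘ₗ (b (src a)).symm.toLinearMap)
  have hY : ∀ a v, Y a *ᵥ v = b (tgt a) (r a ((b (src a)).symm v)) := fun a v => by
    rw [← Matrix.toLin'_apply, Matrix.toLin'_toMatrix']
    rfl
  refine ⟨Y, fun i => (U i).subtype ∘ₗ (b i).symm.toLinearMap, fun i => (b i).toLinearMap ∘ₗ p i,
    fun i v => ?_, fun a v => ?_, fun a v => ?_⟩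
  · simp [p]
  · rw [hY]
    simp only [LinearMap.comp_apply, LinearEquiv.coe_coe, LinearEquiv.symm_apply_apply]
    rfl
  · rw [hY]
    simp only [LinearMap.comp_apply, LinearEquiv.coe_coe, LinearEquiv.symm_apply_apply]
    congr 1
    obtain ⟨u, w, rfl⟩ : ∃ (u : U (src a)) (w : W (src a)), (u : Fin (β (src a)) → K) + w = v := by
      have := (hUW (src a)).sup_eq_top ▸ Submodule.mem_top (x := v)
      obtain ⟨u, hu, w, hw, h⟩ := Submodule.mem_sup.1 this
      exact ⟨⟨u, hu⟩, ⟨w, hw⟩, h⟩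
    have h1 : x a *ᵥ (u : Fin (β (src a)) → K) = ((r a u : U (tgt a)) : Fin (β (tgt a)) → K) := rfl
    have h2 : x a *ᵥ (w : Fin (β (src a)) → K) =
        ((⟨_, hW a w w.2⟩ : W (tgt a)) : Fin (β (tgt a)) → K) := rfl
    rw [Matrix.mulVec_add, h1, h2]
    simp [p]
    exact hW a w w.2

theorem IsSummand.exists_repIso_dsum {K : Type} [Field K] {β γ : I → ℕ} {x : Rep src tgt K β}
    {y : Rep src tgt K γ} (h : IsSummand x y) :
    ∃ (δ : I → ℕ) (z : Rep src tgt K δ), RepIso src tgt x (dsum src tgt y z) := by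
  obtain ⟨A, B, h, hA, hB⟩ := h
  let W : ∀ i, Submodule K (Fin (β i) → K) := fun i => (B i).ker
  have hW : ∀ a, ∀ v ∈ W (src a), x a *ᵥ v ∈ W (tgt a) := fun a v hv => by
    rw [LinearMap.mem_ker] at hv ⊢
    rw [← hB, hv, Matrix.mulVec_zero]
  let b : ∀ i, W i ≃ₗ[K] (Fin (Module.finrank K (W i)) → K) := fun i =>
    (Module.finBasis K (W i)).equivFun
  let r : ∀ a, W (src a) →ₗ[K] W (tgt a) := fun a => (x a).mulVecLin.restrict (hW a)
  let p : ∀ i, (Fin (β i) → K) →ₗ[K] W i := fun i =>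
    (LinearMap.id - A i ∘ₗ B i).codRestrict (W i) fun v => by simp [W, h]
  have hp : ∀ i v, ((p i v : W i) : _ → K) = v - A i (B i v) := fun i v => rfl
  let Z : ∀ a, Matrix (Fin (Module.finrank K (W (tgt a)))) (Fin (Module.finrank K (W (src a)))) K :=
    fun a => LinearMap.toMatrix' ((b (tgt a)).toLinearMap ∘ₗ r a ∘ₗ (b (src a)).symm.toLinearMap)
  have hZ : ∀ a v, Z a *ᵥ v = b (tgt a) (r a ((b (src a)).symm v)) := fun a v => by
    rw [← Matrix.toLin'_apply, Matrix.toLin'_toMatrix']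
    rfl
  let e : ∀ i, (Fin (β i) → K) ≃ₗ[K] (Fin (γ i) → K) × (Fin (Module.finrank K (W i)) → K) :=
    fun i => LinearEquiv.ofLinearMap ((B i).prod ((b i).toLinearMap ∘ₗ p i))
      ((A i).coprod ((W i).subtype ∘ₗ (b i).symm.toLinearMap))
      (by
        refine LinearMap.ext fun v => Prod.ext ?_ ?_
        · have : B i ((b i).symm v.2 : W i) = 0 := ((b i).symm v.2).2
          simp [h, this]
        · have h0 : B i ((b i).symm v.2 : W i) = 0 := ((b i).symm v.2).2
          have h1 : p i (A i v.1 + ((b i).symm v.2 : W i)) = (b i).symm v.2 := by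
            apply Subtype.ext
            rw [hp, map_add, h, h0]
            simp
          exact (congrArg (b i) h1).trans ((b i).apply_symm_apply _))
      (by
        refine LinearMap.ext fun v => ?_
        simp [hp])
  have he : ∀ i v, e i v = (B i v, b i (p i v)) := fun i v => rfl
  refine ⟨fun i => Module.finrank K (W i), Z, repIso_iff.2
    ⟨fun i => (e i).trans (finAddEquivProd K _ _).symm, fun a v => ?_⟩⟩
  have h1 : r a (p (src a) v) = p (tgt a) (x a *ᵥ v) := by
    apply Subtype.ext
    rw [hp, ← hB, ← hA, ← Matrix.mulVec_sub]
    rfl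
  refine (dsum_mulVec_symm (δ := fun i => Module.finrank K (W i)) y Z a (B (src a) v)
    (b (src a) (p (src a) v))).trans ?_
  rw [hB, hZ, LinearEquiv.symm_apply_apply, h1]
  rfl

/-- A set of dimension vectors closed under sums which contains the dimension vectors of all
indecomposable summands of `x` contains that of `x`. -/
theorem mem_of_forall_indec_isSummand_mem [Fintype I] {K : Type} [Field K]
    (V : AddSubmonoid (I → ℕ)) {β : I → ℕ} (x : Rep src tgt K β)
    (h : ∀ (γ : I → ℕ) (y : Rep src tgt K γ), Indec src tgt y → IsSummand x y → γ ∈ V) :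
    β ∈ V := by
  induction hn : ∑ i, β i using Nat.strong_induction_on generalizing β with
  | _ n ih =>
    by_cases hβ : β = 0
    · exact hβ ▸ V.zero_mem
    by_cases hx : Indec src tgt x
    · exact h β x hx (IsSummand.refl x)
    simp only [Indec, not_and, not_forall, not_not] at hx
    obtain ⟨β₁, β₂, y, z, h₁, h₂, hxyz⟩ := hx hβ
    obtain ⟨hy, hz⟩ := IsSummand.of_repIso_dsum hxyz
    have hsum : β = β₁ + β₂ := by
      obtain ⟨e, _⟩ := hxyz
      funext i
      simpa using (e i).finrank_eq
    have hpos : ∀ δ : I → ℕ, δ ≠ 0 → 0 < ∑ i, δ i := fun δ hδ => by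
      obtain ⟨i, hi⟩ := Function.ne_iff.1 hδ
      exact Finset.sum_pos' (fun _ _ => Nat.zero_le _)
        ⟨i, Finset.mem_univ i, Nat.pos_of_ne_zero hi⟩
    have hs : ∑ i, β i = ∑ i, β₁ i + ∑ i, β₂ i := by
      rw [hsum, ← Finset.sum_add_distrib]
      rfl
    have := hpos _ h₁
    have := hpos _ h₂
    rw [hsum]
    exact V.add_mem
      (ih _ (by omega) y (fun γ w hw hyw => h γ w hw (hy.trans hyw)) rfl)
      (ih _ (by omega) z (fun γ w hw hzw => h γ w hw (hz.trans hzw)) rfl)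

end QRep

namespace QRep

variable {I Ω : Type} {src tgt : Ω → I}

open Polynomial

theorem exists_isSummand_finrank_eq_rootMultiplicity {K : Type} [Field K] {β : I → ℕ}
    (x : Rep src tgt K β) (g : ∀ i, Matrix (Fin (β i)) (Fin (β i)) K)
    (hg : ∀ a, g (tgt a) * x a = x a * g (src a)) (μ : K) :
    ∃ y : Rep src tgt K fun i => (g i).charpoly.rootMultiplicity μ, IsSummand x y := by
  let f : ∀ i, Module.End K (Fin (β i) → K) := fun i => Matrix.toLin' (g i) - μ • 1
  have hf : ∀ a v, f (tgt a) (x a *ᵥ v) = x a *ᵥ f (src a) v := fun a v => by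
    simp only [f, LinearMap.sub_apply, Matrix.toLin'_apply, LinearMap.smul_apply,
      Module.End.one_apply, Matrix.mulVec_sub, Matrix.mulVec_smul, Matrix.mulVec_mulVec]
    rw [hg]
  have hfn : ∀ a n v, (f (tgt a) ^ n) (x a *ᵥ v) = x a *ᵥ (f (src a) ^ n) v := fun a n => by
    induction n with
    | zero => exact fun v => rfl
    | succ n ih =>
      intro v
      rw [pow_succ, pow_succ, Module.End.mul_apply, Module.End.mul_apply, hf, ih]
  have hU : ∀ i, (⨆ n, LinearMap.ker (f i ^ n)) =
      Module.End.maxGenEigenspace (Matrix.toLin' (g i)) μ := fun i => by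
    rw [← Module.End.iSup_genEigenspace_eq]
    refine iSup_congr fun n => ?_
    rw [Module.End.genEigenspace_nat]
  obtain ⟨y, hy⟩ := exists_isSummand_of_isCompl x
    (fun i => Module.End.maxGenEigenspace (Matrix.toLin' (g i)) μ)
    (fun i => ⨅ n, LinearMap.range (f i ^ n))
    (fun i => hU i ▸ LinearMap.isCompl_iSup_ker_pow_iInf_range_pow (f i))
    (fun a v hv => by
      rw [Module.End.mem_maxGenEigenspace] at hv ⊢
      obtain ⟨n, hn⟩ := hv
      refine ⟨n, (hfn a n v).trans ?_⟩
      rw [show (f (src a) ^ n) v = 0 from hn, Matrix.mulVec_zero])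
    (fun a v hv => by
      rw [Submodule.mem_iInf] at hv ⊢
      intro n
      obtain ⟨w, rfl⟩ := hv n
      exact ⟨_, hfn a n w⟩)
  have hdim : (fun i => Module.finrank K (Module.End.maxGenEigenspace (Matrix.toLin' (g i)) μ)) =
      fun i => (g i).charpoly.rootMultiplicity μ := funext fun i => by
    rw [LinearMap.finrank_maxGenEigenspace_eq, Matrix.charpoly_toLin']
  exact hdim ▸ ⟨y, hy⟩

/-- The multiplicity of a root of a product of monic irreducible polynomials over a perfect field. -/
theorem rootMultiplicity_map_multiset_prod {F E : Type} [Field F] [PerfectField F]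
    [DecidableEq F[X]] [Field E] [Algebra F E] {P : F[X]} (hP : Irreducible P) (hPm : P.Monic) {μ : E}
    (hμ : aeval μ P = 0) (s : Multiset F[X]) (hs : ∀ Q ∈ s, Irreducible Q ∧ Q.Monic) :
    (s.prod.map (algebraMap F E)).rootMultiplicity μ = s.count P := by
  induction s using Multiset.induction_on with
  | empty => simp
  | cons Q s ih =>
    have hs' : ∀ R ∈ s, Irreducible R ∧ R.Monic := fun R hR => hs R (Multiset.mem_cons_of_mem hR)
    obtain ⟨hQ, hQm⟩ := hs Q (Multiset.mem_cons_self Q s)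
    have hsm : s.prod.Monic := by
      simpa using monic_multiset_prod_of_monic s id fun R hR => (hs' R hR).2
    have hone : (Q.map (algebraMap F E)).rootMultiplicity μ = if P = Q then 1 else 0 := by
      split_ifs with h
      · subst h
        refine le_antisymm (rootMultiplicity_le_one_of_separable
          (PerfectField.separable_of_irreducible hP).map μ) ?_
        rw [Nat.succ_le_iff, rootMultiplicity_pos (hPm.map _).ne_zero, IsRoot.def, eval_map_algebraMap]
        exact hμ
      · refine rootMultiplicity_eq_zero fun h0 => h ?_
        rw [IsRoot.def, eval_map_algebraMap] at h0
        rw [minpoly.eq_of_irreducible_of_monic hP hμ hPm,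
          minpoly.eq_of_irreducible_of_monic hQ h0 hQm]
    rw [Multiset.prod_cons, Polynomial.map_mul,
      rootMultiplicity_mul ((hQm.map _).mul (hsm.map _)).ne_zero, ih hs', hone,
      Multiset.count_cons, add_comm]

theorem sign_coeff_zero_multiset_prod {F : Type} [Field F] (s : Multiset F[X])
    (hs : ∀ Q ∈ s, Q.Monic) :
    (-1) ^ s.prod.natDegree * s.prod.coeff 0 =
      (s.map fun Q => (-1) ^ Q.natDegree * Q.coeff 0).prod := by
  induction s using Multiset.induction_on with
  | empty => simp
  | cons Q s ih =>
    have hs' : ∀ R ∈ s, R.Monic := fun R hR => hs R (Multiset.mem_cons_of_mem hR)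
    have hQ := hs Q (Multiset.mem_cons_self Q s)
    have hsm : s.prod.Monic := by simpa using monic_multiset_prod_of_monic s id hs'
    rw [Multiset.map_cons, Multiset.prod_cons, Multiset.prod_cons, ← ih hs',
      hQ.natDegree_mul hsm, mul_coeff_zero, pow_add]
    ring

theorem prod_character_det_eq_one_s4 [Fintype I] {F E : Type} [Field F] [Fintype F] [Field E]
    [Algebra F E] [IsAlgClosed E] {α : I → ℕ} (g : ∀ i, GL (Fin (α i)) F) (σ : I → (Fˣ →* ℂˣ))
    (h : ∀ μ : E, ∏ i, (σ i) ^
      (((g i).val.map (algebraMap F E)).charpoly.rootMultiplicity μ) = 1) :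
    ∏ i, σ i (Matrix.GeneralLinearGroup.det (g i)) = 1 := by
  classical
  let s : I → Multiset F[X] := fun i =>
    UniqueFactorizationMonoid.normalizedFactors (g i).val.charpoly
  have hs : ∀ i, ∀ Q ∈ s i, Irreducible Q ∧ Q.Monic := fun i Q hQ =>
    have h0 := (Matrix.charpoly_monic (g i).val).ne_zero
    ⟨((Polynomial.mem_normalizedFactors_iff h0).1 hQ).1,
      ((Polynomial.mem_normalizedFactors_iff h0).1 hQ).2.1⟩
  have hprod : ∀ i, (s i).prod = (g i).val.charpoly := fun i => by
    have hm := Matrix.charpoly_monic (g i).val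
    rw [UniqueFactorizationMonoid.prod_normalizedFactors_eq hm.ne_zero, hm.normalize_eq_self]
  let N : F[X] → F := fun Q => (-1) ^ Q.natDegree * Q.coeff 0
  have hdet : ∀ i, (g i).val.det = ((s i).map N).prod := fun i => by
    rw [← sign_coeff_zero_multiset_prod _ fun Q hQ => (hs i Q hQ).2, hprod,
      Matrix.det_eq_sign_charpoly_coeff, Matrix.charpoly_natDegree_eq_dim]
  let T : Finset F[X] := Finset.univ.biUnion fun i => (s i).toFinset
  have hdet' : ∀ i, (g i).val.det = ∏ Q ∈ T, N Q ^ (s i).count Q := fun i => by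
    rw [hdet, Finset.prod_multiset_map_count]
    refine Finset.prod_subset (Finset.subset_biUnion_of_mem (fun i => (s i).toFinset)
      (Finset.mem_univ i)) fun Q _ hQ => ?_
    rw [Multiset.mem_toFinset] at hQ
    rw [Multiset.count_eq_zero_of_notMem hQ, pow_zero]
  have hT : ∀ Q ∈ T, ∃ i, Q ∈ s i := fun Q hQ => by simpa [T] using hQ
  let χ : ∀ _ : I, MulChar F ℂ := fun i => MulChar.ofUnitHom (σ i)
  have hχ : ∀ i (u : Fˣ), χ i (u : F) = (σ i u : ℂ) := fun i u => MulChar.ofUnitHom_coe _ _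
  have key : ∏ i, χ i ((g i).val.det) = 1 := by
    simp only [hdet', map_prod, map_pow]
    rw [Finset.prod_comm]
    refine Finset.prod_eq_one fun Q hQ => ?_
    obtain ⟨j, hj⟩ := hT Q hQ
    obtain ⟨hQi, hQm⟩ := hs j Q hj
    have hN : N Q ≠ 0 := fun h0 => by
      have h1 : (g j).val.det ≠ 0 := ((Matrix.isUnit_iff_isUnit_det _).1 (g j).isUnit).ne_zero
      rw [hdet] at h1
      exact h1 (Multiset.prod_eq_zero (h0 ▸ Multiset.mem_map_of_mem N hj))
    obtain ⟨μ, hμ⟩ := IsAlgClosed.exists_aeval_eq_zero E Q (degree_pos_of_irreducible hQi).ne'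
    have hcount : ∀ i, ((g i).val.map (algebraMap F E)).charpoly.rootMultiplicity μ =
        (s i).count Q := fun i => by
      rw [Matrix.charpoly_map, ← hprod]
      exact rootMultiplicity_map_multiset_prod hQi hQm hμ (s i) (hs i)
    have h1 := congrArg (fun τ : Fˣ →* ℂˣ => ((τ (Units.mk0 _ hN) : ℂˣ) : ℂ)) (h μ)
    simpa [hcount, ← hχ] using h1
  ext
  rw [Units.coe_prod, Units.val_one, ← key]
  exact Finset.prod_congr rfl fun i _ => (hχ i _).symm

theorem character_eq_one_of_levelAtMost [Fintype I] {F : Type} [Field F] [Fintype F] {α : I → ℕ}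
    (x : Rep src tgt F α) (σ : I → (Fˣ →* ℂˣ))
    (hx : LevelAtMost src tgt x {δ | ∏ i, (σ i) ^ (δ i) = 1}) (g : ∀ i, GL (Fin (α i)) F)
    (hg : glAct src tgt g x = x) :
    ∏ i, σ i (Matrix.GeneralLinearGroup.det (g i)) = 1 := by
  let E := AlgebraicClosure F
  refine prod_character_det_eq_one_s4 (E := E) g σ fun μ => ?_
  obtain ⟨y, hy⟩ := exists_isSummand_finrank_eq_rootMultiplicity
    (baseChange src tgt (algebraMap F E) x) (fun i => (g i).val.map (algebraMap F E))
    (fun a => (Matrix.map_mul (L := (g (tgt a)).val) (M := x a) (f := algebraMap F E)).symm.trans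
      ((congrArg (fun M => M.map (algebraMap F E)) ((glAct_eq_iff g x x).1 hg a)).trans
        (Matrix.map_mul (L := x a) (M := (g (src a)).val) (f := algebraMap F E)))) μ
  let V : AddSubmonoid (I → ℕ) :=
    { carrier := {δ | ∏ i, (σ i) ^ (δ i) = 1}
      zero_mem' := Finset.prod_eq_one fun i _ => pow_zero (σ i)
      add_mem' := fun {δ ε} hδ hε =>
        calc ∏ i, (σ i) ^ (δ i + ε i) = ∏ i, ((σ i) ^ (δ i) * (σ i) ^ (ε i)) :=
              Finset.prod_congr rfl fun i _ => pow_add (σ i) _ _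
          _ = 1 := by
              rw [Finset.prod_mul_distrib, show ∏ i, (σ i) ^ (δ i) = 1 from hδ,
                show ∏ i, (σ i) ^ (ε i) = 1 from hε]
              exact mul_one (1 : Fˣ →* ℂˣ) }
  refine mem_of_forall_indec_isSummand_mem V y fun γ w hw hyw => ?_
  obtain ⟨δ, z, hz⟩ := (hy.trans hyw).exists_repIso_dsum
  exact hx γ δ w z hw hz

end QRep

open QRep in
/-- The averaged character sum
`(1/|GL_α(𝔽_q)|) Σ_g #{x : g·x = x} · ρ(g)` equals the number of `GL_α(𝔽_q)`-orbits of
representations all of whose indecomposable direct summands over `𝔽̄_q` have dimension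
vector `δ` with `σ^δ = 1`. -/
theorem statement4 (I Ω : Type) [Fintype I] [Fintype Ω] (src tgt : Ω → I)
    (F : Type) [Field F] [Fintype F] (α : I → ℕ) (σ : I → (Fˣ →* ℂˣ)) :
    (Nat.card (∀ i, GL (Fin (α i)) F) : ℂ)⁻¹ *
      ∑ᶠ g : ∀ i, GL (Fin (α i)) F,
        (Nat.card {x : Rep src tgt F α // glAct src tgt g x = x} : ℂ) *
          ((∏ i, σ i (Matrix.GeneralLinearGroup.det (g i)) : ℂˣ) : ℂ) =
    (orbitCount src tgt (K := F) α
      (fun x => LevelAtMost src tgt x {δ | ∏ i, (σ i) ^ (δ i) = 1}) : ℂ) := by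
  let χ : (∀ i, GL (Fin (α i)) F) →* ℂˣ :=
    { toFun := fun g => ∏ i, σ i (Matrix.GeneralLinearGroup.det (g i))
      map_one' := by simp
      map_mul' := fun g h => by simp [Finset.prod_mul_distrib] }
  have hlevel : (fun x : Rep src tgt F α =>
      LevelAtMost src tgt x {δ | ∏ i, (σ i) ^ (δ i) = 1}) =
      fun x => ∀ g, glAct src tgt g x = x → χ g = 1 := funext fun x => propext
    ⟨fun hx g hg => character_eq_one_of_levelAtMost x σ hx g hg,
      fun hx => levelAtMost_of_character_eq_one x σ hx⟩
  rw [hlevel]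
  let _ := glMulAction src tgt F α
  have : Finite (Rep src tgt F α) :=
    inferInstanceAs (Finite (∀ a, Matrix (Fin (α (tgt a))) (Fin (α (src a))) F))
  exact average_card_fixedBy_mul_character (X := Rep src tgt F α) χ
end
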